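/- arXiv:0904.3957 — 2 statements merged into one kernel-verified Lean document; each statement's English description precedes it below -/
import Mathlib

section
/- The assignment ξ̂(δ_K) = δ_{ξ^{-1}(K)} for K ∈ Pl(n,m+n) with K ≠ [m+1,…,m+n], together with ξ̂(δ_{[m+1,…,m+n]}) = 1, extends to a surjective ℂ-algebra homomorphism ξ̂ from the SL_n-invariant subalgebra ℂ[M_{n,m+n}]^{SL_n} onto ℂ[M_{n,m}], and its kernel is the ideal of ℂ[M_{n,m+n}]^{SL_n} generated by δ_{[m+1,…,m+n]} − 1; hence ℂ[M_{n,m+n}]^{SL_n}/(δ_{[m+1,…,m+n]} − 1) ≅ ℂ[M_{n,m}]. -/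
noncomputable section

/-- One-line tableau predicate: `isTab n m I J` says `[I:J]` is a one-line tableau in `D(n,m)`,
i.e. `I ⊆ {1,…,n}` and `J ⊆ {1,…,m}` are strictly increasing sequences of the same (positive) length. -/
def isTab (n m : ℕ) (I J : List ℕ) : Prop :=
  I.length = J.length ∧ I ≠ [] ∧ I.Chain' (· < ·) ∧ J.Chain' (· < ·) ∧
    (∀ x ∈ I, 1 ≤ x ∧ x ≤ n) ∧ ∀ x ∈ J, 1 ≤ x ∧ x ≤ m

/-- The tableau order `A ⪯ B` on one-line tableaux. -/
def tleq (A B : List ℕ × List ℕ) : Prop :=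
  B.1.length ≤ A.1.length ∧
    ∀ r < B.1.length, A.1.getD r 0 ≤ B.1.getD r 0 ∧ A.2.getD r 0 ≤ B.2.getD r 0

/-- The map ξ : `ξ([I:J]) = [j₁,…,jₕ, m+u₁,…,m+u_{n−h}]` where
`{n+1−u₁,…,n+1−u_{n−h}}` is the complement of `I` in `{1,…,n}`. -/
def xi (n m : ℕ) (I J : List ℕ) : List ℕ :=
  J ++ ((((List.range n).map (· + 1)).filter fun c => decide (c ∉ I)).reverse.map
      fun c => m + (n + 1 - c))

/-- The top element `[m+1, …, m+n]`. -/
def topL (n m : ℕ) : List ℕ := (List.range n).map fun r => m + r + 1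

/-- `dmin n m I J` is the minor δ_{[I:J]} ∈ ℂ[M_{n,m}] : the determinant of the submatrix of
the generic n×m matrix of variables with rows `I` and columns `J` (1-based indices). -/
def dmin (n m : ℕ) (I J : List ℕ) : MvPolynomial (Fin n × Fin m) ℂ :=
  Matrix.det (Matrix.of fun a b : Fin I.length =>
    if h : I.getD a 0 - 1 < n ∧ J.getD b 0 - 1 < m then
      MvPolynomial.X (⟨I.getD a 0 - 1, h.1⟩, ⟨J.getD b 0 - 1, h.2⟩)
    else 0)

/-- `memPl n M K` : `K` is a strictly increasing sequence of length `n` in `{1,…,M}`,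
i.e. an element of `Pl(n,M)`. -/
def memPl (n M : ℕ) (K : List ℕ) : Prop :=
  K.length = n ∧ K.Chain' (· < ·) ∧ ∀ x ∈ K, 1 ≤ x ∧ x ≤ M

/-- The maximal minor δ_K ∈ ℂ[M_{n,m+n}], with all `n` rows and columns `K`. -/
def pld (n m : ℕ) (K : List ℕ) : MvPolynomial (Fin n × Fin (m + n)) ℂ :=
  dmin n (m + n) ((List.range n).map (· + 1)) K

/-- The algebra endomorphism of ℂ[M_{n,N}] induced by left multiplication by `g` on matrices :
`x_{ij} ↦ ∑_a g_{ia} x_{aj}`. -/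
def actHom (n N : ℕ) (g : Matrix (Fin n) (Fin n) ℂ) :
    MvPolynomial (Fin n × Fin N) ℂ →ₐ[ℂ] MvPolynomial (Fin n × Fin N) ℂ :=
  MvPolynomial.aeval fun q : Fin n × Fin N =>
    ∑ a : Fin n, MvPolynomial.C (g q.1 a) * MvPolynomial.X (a, q.2)

/-- The subalgebra of `SL_n`-invariants of ℂ[M_{n,N}]. -/
def invAlg (n N : ℕ) : Subalgebra ℂ (MvPolynomial (Fin n × Fin N) ℂ) where
  carrier := {f | ∀ g : Matrix.SpecialLinearGroup (Fin n) ℂ, actHom n N g.1 f = f}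
  mul_mem' := fun ha hb g => by rw [map_mul, ha g, hb g]
  one_mem' := fun g => by rw [map_one]
  add_mem' := fun ha hb g => by rw [map_add, ha g, hb g]
  zero_mem' := fun g => by rw [map_zero]
  algebraMap_mem' := fun c g => (actHom n N g.1).commutes c

/-- The determinant of the columns `κ` of the generic `n × N` matrix. -/
def colMinor {n N : ℕ} (κ : Fin n → Fin N) : MvPolynomial (Fin n × Fin N) ℂ :=
  Matrix.det (Matrix.of fun a b => MvPolynomial.X (a, κ b))

lemma map_colMinor {n N : ℕ} {R : Type*} [CommRing R] [Algebra ℂ R]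
    (ψ : MvPolynomial (Fin n × Fin N) ℂ →ₐ[ℂ] R) (κ : Fin n → Fin N) :
    ψ (colMinor κ) = Matrix.det (Matrix.of fun a b => ψ (MvPolynomial.X (a, κ b))) := by
  rw [colMinor, AlgHom.map_det]
  rfl

lemma colMinor_mem_invAlg {n N : ℕ} (κ : Fin n → Fin N) : colMinor κ ∈ invAlg n N := by
  intro g
  have h : (Matrix.of fun a b => actHom n N g.1 (MvPolynomial.X (a, κ b))) =
      g.1.map (MvPolynomial.C : ℂ →+* MvPolynomial (Fin n × Fin N) ℂ) *
        Matrix.of fun a b => MvPolynomial.X (a, κ b) := by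
    ext1 a b
    simp [actHom, Matrix.mul_apply]
  have hdet : (g.1.map (MvPolynomial.C : ℂ →+* MvPolynomial (Fin n × Fin N) ℂ)).det = 1 := by
    have := (RingHom.map_det (MvPolynomial.C : ℂ →+* MvPolynomial (Fin n × Fin N) ℂ) g.1).symm
    rw [g.2, map_one] at this
    exact this
  rw [map_colMinor, h, Matrix.det_mul, hdet, one_mul, colMinor]

lemma memPl_getD {n M : ℕ} {K : List ℕ} (hK : memPl n M K) (b : Fin n) :
    1 ≤ K.getD (b : ℕ) 0 ∧ K.getD (b : ℕ) 0 ≤ M := by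
  have hb : (b : ℕ) < K.length := by rw [hK.1]; exact b.2
  rw [List.getD_eq_getElem _ _ hb]
  exact hK.2.2 _ (List.getElem_mem hb)

lemma pld_eq_colMinor {n m : ℕ} {K : List ℕ} (κ : Fin n → Fin (m + n)) (hκ : ∀ b : Fin n, K.getD (b : ℕ) 0 = κ b + 1) :
    pld n m K = colMinor κ := by
  have hlen : ((List.range n).map (· + 1)).length = n := by simp
  rw [colMinor, ← Matrix.det_submatrix_equiv_self (finCongr hlen), pld, dmin]
  congr 1
  ext1 a b
  have ha : (a : ℕ) < n := by simpa using a.2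
  have hb := hκ (finCongr hlen b)
  simp only [finCongr_apply, Fin.val_cast] at hb
  have h1 : ((List.range n).map (· + 1)).getD (a : ℕ) 0 = (a : ℕ) + 1 := by
    rw [List.getD_eq_getElem _ _ a.2]; simp
  simp only [Matrix.of_apply, Matrix.submatrix_apply, h1, hb, Nat.add_sub_cancel]
  rw [dif_pos ⟨ha, (κ _).2⟩]
  rfl

lemma pld_mem_invAlg {n m : ℕ} {K : List ℕ} (hK : memPl n (m + n) K) :
    pld n m K ∈ invAlg n (m + n) := by
  have h := memPl_getD hK
  rw [pld_eq_colMinor (fun b : Fin n => ⟨K.getD (b : ℕ) 0 - 1, by have := h b; omega⟩)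
    (fun b : Fin n => (Nat.sub_add_cancel (h b).1).symm)]
  exact colMinor_mem_invAlg _

lemma topL_memPl (n m : ℕ) : memPl n (m + n) (topL n m) := by
  refine ⟨by simp [topL], ?_, ?_⟩
  · show List.IsChain _ _
    rw [topL, List.isChain_map]
    refine (List.isChain_iff_getElem).2 fun i hi => ?_
    simp
  · intro x hx
    simp only [topL, List.mem_map, List.mem_range] at hx
    obtain ⟨r, hr, rfl⟩ := hx
    omega

lemma pld_topL (n m : ℕ) : pld n m (topL n m) = colMinor (Fin.natAdd m) :=
  pld_eq_colMinor _ fun b : Fin n => by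
    rw [List.getD_eq_getElem _ _ (by simp [topL])]
    simp [topL]

/-- The diagonal entries of `antidiag` : all equal to `1`, except the first, which is the sign of
the reversal permutation. -/
def antidiagEntry (n : ℕ) (u : Fin n) : ℂ :=
  if u.1 = 0 then ((Equiv.Perm.sign (Fin.revPerm : Equiv.Perm (Fin n)) : ℤ) : ℂ) else 1

lemma antidiagEntry_eq_or (n : ℕ) (u : Fin n) :
    antidiagEntry n u = 1 ∨ antidiagEntry n u = -1 := by
  unfold antidiagEntry
  split_ifs
  · rcases Int.units_eq_one_or (Equiv.Perm.sign (Fin.revPerm : Equiv.Perm (Fin n))) with h | h <;>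
      simp [h]
  · simp

/-- The antidiagonal matrix with entries `±1` and determinant `1`. -/
def antidiag (n : ℕ) : Matrix (Fin n) (Fin n) ℂ :=
  (Matrix.diagonal (antidiagEntry n)).submatrix Fin.revPerm id

lemma antidiag_apply {n : ℕ} (a u : Fin n) :
    antidiag n a u = if a = u.rev then antidiagEntry n u else 0 := by
  simp only [antidiag, Matrix.submatrix_apply, Fin.revPerm_apply, id, Matrix.diagonal_apply]
  by_cases h : a.rev = u
  · subst h; simp
  · rw [if_neg h, if_neg]
    rintro rfl
    simp at h

lemma det_antidiag {n : ℕ} (hn : 0 < n) : (antidiag n).det = 1 := by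
  rw [antidiag, Matrix.det_permute, Matrix.det_diagonal,
    Finset.prod_eq_single (⟨0, hn⟩ : Fin n)]
  · rw [antidiagEntry, if_pos rfl, ← Int.cast_mul, ← Units.val_mul, Int.units_mul_self]
    simp
  · intro b _ hb
    rw [antidiagEntry, if_neg fun h => hb (Fin.ext h)]
  · simp

/-- The entries of the block matrix `[X | antidiag]`, where `X` is the generic `n × m` matrix. -/
def augEntry (n m : ℕ) (p : Fin n × Fin (m + n)) : MvPolynomial (Fin n × Fin m) ℂ :=
  Fin.addCases (fun j => MvPolynomial.X (p.1, j))
    (fun u => MvPolynomial.C (antidiag n p.1 u)) p.2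

@[simp]
lemma augEntry_castAdd {n m : ℕ} (a : Fin n) (j : Fin m) :
    augEntry n m (a, Fin.castAdd n j) = MvPolynomial.X (a, j) := by
  simp [augEntry]

@[simp]
lemma augEntry_natAdd {n m : ℕ} (a u : Fin n) :
    augEntry n m (a, Fin.natAdd m u) = MvPolynomial.C (antidiag n a u) := by
  simp [augEntry]

/-- Substitution of the block matrix `[X | antidiag]` for the generic `n × (m + n)` matrix. -/
def specialize (n m : ℕ) :
    MvPolynomial (Fin n × Fin (m + n)) ℂ →ₐ[ℂ] MvPolynomial (Fin n × Fin m) ℂ :=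
  MvPolynomial.aeval (augEntry n m)

lemma specialize_colMinor {n m : ℕ} (κ : Fin n → Fin (m + n)) :
    specialize n m (colMinor κ) = Matrix.det (Matrix.of fun a b => augEntry n m (a, κ b)) := by
  rw [map_colMinor]
  simp [specialize]

lemma det_map_antidiag {n m : ℕ} (hn : 0 < n) :
    ((antidiag n).map (MvPolynomial.C : ℂ →+* MvPolynomial (Fin n × Fin m) ℂ)).det = 1 := by
  have := (RingHom.map_det (MvPolynomial.C : ℂ →+* MvPolynomial (Fin n × Fin m) ℂ)
    (antidiag n)).symm
  rw [det_antidiag hn, map_one] at this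
  exact this

lemma specialize_top {n m : ℕ} (hn : 0 < n) :
    specialize n m (colMinor (Fin.natAdd m)) = 1 := by
  rw [specialize_colMinor, ← det_map_antidiag (m := m) hn]
  congr 1
  ext1 a b
  simp

lemma exists_specialize_eq_X {n m : ℕ} (hn : 0 < n) (i : Fin n) (j : Fin m) :
    ∃ f ∈ invAlg n (m + n), specialize n m f = MvPolynomial.X (i, j) := by
  refine ⟨MvPolynomial.C (antidiagEntry n i.rev) *
    colMinor (fun b => if b = i.rev then Fin.castAdd n j else Fin.natAdd m b),
    mul_mem ((invAlg n (m + n)).algebraMap_mem _) (colMinor_mem_invAlg _), ?_⟩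
  have h := congrFun (Matrix.mulVec_cramer
    ((antidiag n).map (MvPolynomial.C : ℂ →+* MvPolynomial (Fin n × Fin m) ℂ))
    (fun a => MvPolynomial.X (a, j))) i
  rw [det_map_antidiag hn, one_smul, Matrix.mulVec, dotProduct,
    Finset.sum_eq_single i.rev, Matrix.cramer_apply] at h
  · rw [← h, map_mul, specialize_colMinor]
    congr 1
    · simp [antidiag_apply, specialize, MvPolynomial.algebraMap_eq]
    · congr 1
      ext1 a b
      by_cases hb : b = i.rev <;> simp [hb]
  · intro b _ hb
    rw [Matrix.map_apply, antidiag_apply, if_neg, map_zero, zero_mul]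
    rintro rfl
    simp at hb
  · simp

lemma eval_actHom {n N : ℕ} (g : Matrix (Fin n) (Fin n) ℂ) (M : Matrix (Fin n) (Fin N) ℂ)
    (f : MvPolynomial (Fin n × Fin N) ℂ) :
    MvPolynomial.eval (fun p => M p.1 p.2) (actHom n N g f) =
      MvPolynomial.eval (fun p => (g * M) p.1 p.2) f := by
  induction f using MvPolynomial.induction_on with
  | C a => simp [actHom]
  | add p q hp hq => simp [hp, hq]
  | mul_X p i hp =>
    rw [map_mul, map_mul, map_mul, hp]
    simp [actHom, Matrix.mul_apply]

lemma eval_specialize {n m : ℕ} (A : Matrix (Fin n) (Fin m) ℂ) (M : Matrix (Fin n) (Fin (m + n)) ℂ)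
    (hA : ∀ a j, M a (Fin.castAdd n j) = A a j)
    (hM : ∀ a u, M a (Fin.natAdd m u) = antidiag n a u)
    (f : MvPolynomial (Fin n × Fin (m + n)) ℂ) :
    MvPolynomial.eval (fun p => A p.1 p.2) (specialize n m f) =
      MvPolynomial.eval (fun p => M p.1 p.2) f := by
  induction f using MvPolynomial.induction_on with
  | C a => simp [specialize]
  | add p q hp hq => simp [hp, hq]
  | mul_X p i hp =>
    rw [map_mul, map_mul, map_mul, hp]
    congr 1
    obtain ⟨a, k⟩ := i
    induction k using Fin.addCases <;> simp [specialize, hA, hM]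

lemma eval_smul_of_isHomogeneous {σ : Type*} {f : MvPolynomial σ ℂ} {D : ℕ}
    (hf : f.IsHomogeneous D) (c : ℂ) (x : σ → ℂ) :
    MvPolynomial.eval (fun p => c * x p) f = c ^ D * MvPolynomial.eval x f := by
  rw [MvPolynomial.eval_eq, MvPolynomial.eval_eq, Finset.mul_sum]
  refine Finset.sum_congr rfl fun d hd => ?_
  have h := hf (MvPolynomial.mem_support_iff.1 hd)
  simp only [Finsupp.weight_apply, Finsupp.sum, Pi.one_apply, smul_eq_mul, mul_one] at h
  rw [Finset.prod_congr rfl fun i _ => mul_pow c (x i) (d i), Finset.prod_mul_distrib,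
    Finset.prod_pow_eq_pow_sum, h]
  ring

lemma eq_zero_of_isHomogeneous {n m D : ℕ} (hn : 0 < n) {f : MvPolynomial (Fin n × Fin (m + n)) ℂ}
    (hf : f ∈ invAlg n (m + n)) (hD : f.IsHomogeneous D) (h0 : specialize n m f = 0) : f = 0 := by
  have ht : (colMinor (Fin.natAdd m) : MvPolynomial (Fin n × Fin (m + n)) ℂ) ≠ 0 := by
    intro h
    have := specialize_top (m := m) hn
    rw [h, map_zero] at this
    exact zero_ne_one this
  refine (mul_eq_zero.1 (MvPolynomial.funext fun x => ?_ :
    colMinor (Fin.natAdd m) * f = 0)).resolve_left ht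
  rw [map_mul, map_zero]
  set M : Matrix (Fin n) (Fin (m + n)) ℂ := Matrix.of fun a b => x (a, b) with hMdef
  set B : Matrix (Fin n) (Fin n) ℂ := M.submatrix id (Fin.natAdd m) with hB
  have hev : MvPolynomial.eval x (colMinor (Fin.natAdd m)) = B.det := by
    have := map_colMinor (MvPolynomial.aeval (R := ℂ) x) (Fin.natAdd m)
    rw [← MvPolynomial.aeval_eq_eval, this]
    congr 1
    ext1 a b
    simp [hB, hMdef]
  rw [hev]
  by_cases hdet : B.det = 0
  · rw [hdet, zero_mul]
  obtain ⟨c, hc⟩ := IsAlgClosed.exists_pow_nat_eq B.det hn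
  have hc0 : c ≠ 0 := by
    rintro rfl
    rw [zero_pow hn.ne'] at hc
    exact hdet hc.symm
  set W := antidiag n
  have hW : IsUnit W.det := by rw [det_antidiag hn]; exact isUnit_one
  have hBu : IsUnit B.det := isUnit_iff_ne_zero.2 hdet
  let g : Matrix.SpecialLinearGroup (Fin n) ℂ := ⟨c⁻¹ • (B * W⁻¹), by
    rw [Matrix.det_smul, Matrix.det_mul, Matrix.det_nonsing_inv, det_antidiag hn, Fintype.card_fin,
      ← hc, Ring.inverse_one, mul_one, ← mul_pow, inv_mul_cancel₀ hc0, one_pow]⟩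
  set Y := W * B⁻¹ * M with hY
  have hgY : M = c • (g.1 * Y) := by
    rw [hY]
    simp only [g, Matrix.smul_mul, smul_smul, mul_inv_cancel₀ hc0, one_smul]
    rw [Matrix.mul_assoc B, ← Matrix.mul_assoc W⁻¹, ← Matrix.mul_assoc W⁻¹,
      Matrix.nonsing_inv_mul _ hW, Matrix.one_mul, Matrix.mul_nonsing_inv_cancel_left _ _ hBu]
  have hYB : ∀ a u, Y a (Fin.natAdd m u) = W a u := by
    intro a u
    have : Y.submatrix id (Fin.natAdd m) = W * B⁻¹ * B := by
      rw [hY, hB]; rfl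
    rw [Matrix.mul_assoc, Matrix.nonsing_inv_mul _ hBu, Matrix.mul_one] at this
    rw [← this]; rfl
  have hx : x = fun p => c * (g.1 * Y) p.1 p.2 := by
    funext p
    have := congrFun (congrFun hgY p.1) p.2
    simpa [hMdef] using this
  rw [hx, eval_smul_of_isHomogeneous hD, ← eval_actHom, hf g,
    ← eval_specialize (Y.submatrix id (Fin.castAdd n)) Y (fun _ _ => rfl) hYB, h0]
  simp

lemma colMinor_isHomogeneous {n N : ℕ} (κ : Fin n → Fin N) :
    (colMinor κ : MvPolynomial (Fin n × Fin N) ℂ).IsHomogeneous n := by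
  rw [colMinor, Matrix.det_apply']
  refine MvPolynomial.IsHomogeneous.sum _ _ _ fun σ _ => ?_
  have h := MvPolynomial.IsHomogeneous.prod Finset.univ
    (fun i : Fin n => (MvPolynomial.X (σ i, κ i) : MvPolynomial (Fin n × Fin N) ℂ)) (fun _ => 1)
    fun i _ => MvPolynomial.isHomogeneous_X _ _
  have h' := (MvPolynomial.isHomogeneous_C (Fin n × Fin N)
    (((Equiv.Perm.sign σ : ℤˣ) : ℤ) : ℂ)).mul h
  simpa using h'

lemma homogeneousComponent_actHom {n N : ℕ} (g : Matrix (Fin n) (Fin n) ℂ) (d : ℕ)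
    (f : MvPolynomial (Fin n × Fin N) ℂ) :
    MvPolynomial.homogeneousComponent d (actHom n N g f) =
      actHom n N g (MvPolynomial.homogeneousComponent d f) := by
  have hom (e : ℕ) : (actHom n N g (MvPolynomial.homogeneousComponent e f)).IsHomogeneous e := by
    have := (MvPolynomial.homogeneousComponent_isHomogeneous e f).aeval
      (fun q : Fin n × Fin N => ∑ a : Fin n, MvPolynomial.C (g q.1 a) * MvPolynomial.X (a, q.2))
      (n := 1) fun q => MvPolynomial.IsHomogeneous.sum _ _ _ fun a _ => by
        simpa using (MvPolynomial.isHomogeneous_C (Fin n × Fin N) (g q.1 a)).mul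
          (MvPolynomial.isHomogeneous_X ℂ (a, q.2))
    simpa [actHom] using this
  conv_lhs => rw [← MvPolynomial.sum_homogeneousComponent f, map_sum, map_sum]
  rw [Finset.sum_congr rfl fun e _ =>
    MvPolynomial.homogeneousComponent_of_mem (m := d) (hom e)]
  rw [Finset.sum_ite_eq]
  split_ifs with h
  · rfl
  · rw [MvPolynomial.homogeneousComponent_eq_zero, map_zero]
    simpa [Nat.lt_succ_iff] using h

lemma homogeneousComponent_mem_invAlg {n N : ℕ} {f : MvPolynomial (Fin n × Fin N) ℂ}
    (hf : f ∈ invAlg n N) (d : ℕ) : MvPolynomial.homogeneousComponent d f ∈ invAlg n N := by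
  intro g
  rw [← homogeneousComponent_actHom, hf g]

lemma dvd_of_isHomogeneous_of_mem_invAlg {n N d : ℕ} (hn : 0 < n)
    {f : MvPolynomial (Fin n × Fin N) ℂ} (hf : f ∈ invAlg n N) (hd : f.IsHomogeneous d)
    (h0 : f ≠ 0) : n ∣ d := by
  have hζ := Complex.isPrimitiveRoot_exp n hn.ne'
  set ζ := Complex.exp (2 * Real.pi * Complex.I / n)
  let g : Matrix.SpecialLinearGroup (Fin n) ℂ := ⟨ζ • 1, by
    rw [Matrix.det_smul, Matrix.det_one, Fintype.card_fin, hζ.pow_eq_one, mul_one]⟩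
  obtain ⟨x, hx⟩ : ∃ x, MvPolynomial.eval x f ≠ 0 := by
    by_contra! h
    exact h0 (MvPolynomial.funext fun x => by rw [h, map_zero])
  have h1 := eval_actHom g.1 (Matrix.of fun a b => x (a, b)) f
  rw [hf g] at h1
  simp only [g, Matrix.smul_mul, Matrix.one_mul, Matrix.smul_apply, Matrix.of_apply, Prod.mk.eta,
    smul_eq_mul] at h1
  rw [eval_smul_of_isHomogeneous hd] at h1
  exact hζ.dvd_of_pow_eq_one d (mul_right_cancel₀ hx (by rw [one_mul]; exact h1.symm))

lemma mem_span_of_specialize_eq_zero {n m : ℕ} (hn : 0 < n) (f T : invAlg n (m + n))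
    (hT : (T : MvPolynomial (Fin n × Fin (m + n)) ℂ) = colMinor (Fin.natAdd m))
    (hf : specialize n m f = 0) : f ∈ Ideal.span {T - 1} := by
  set N := (f : MvPolynomial (Fin n × Fin (m + n)) ℂ).totalDegree
  let c (d : ℕ) : invAlg n (m + n) := ⟨_, homogeneousComponent_mem_invAlg f.2 d⟩
  have hsum : f = ∑ d ∈ Finset.range (N + 1), c d := by
    apply Subtype.ext
    rw [AddSubmonoidClass.coe_finsetSum]
    exact (MvPolynomial.sum_homogeneousComponent _).symm
  let F : invAlg n (m + n) := ∑ d ∈ Finset.range (N + 1), T ^ (N - d / n) * c d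
  have hFval : (F : MvPolynomial (Fin n × Fin (m + n)) ℂ) =
      ∑ d ∈ Finset.range (N + 1), colMinor (Fin.natAdd m) ^ (N - d / n) *
        MvPolynomial.homogeneousComponent d f := by
    simp only [F, AddSubmonoidClass.coe_finsetSum, MulMemClass.coe_mul, SubmonoidClass.coe_pow, hT]
    rfl
  have hF : F = 0 := by
    refine Subtype.ext (eq_zero_of_isHomogeneous (D := n * N) hn F.2 ?_ ?_)
    · rw [hFval]
      refine MvPolynomial.IsHomogeneous.sum _ _ _ fun d hd => ?_
      by_cases h0 : MvPolynomial.homogeneousComponent d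
          (f : MvPolynomial (Fin n × Fin (m + n)) ℂ) = 0
      · rw [h0, mul_zero]
        exact MvPolynomial.isHomogeneous_zero _ _ _
      · have hom := MvPolynomial.homogeneousComponent_isHomogeneous d
          (f : MvPolynomial (Fin n × Fin (m + n)) ℂ)
        obtain ⟨k, rfl⟩ := dvd_of_isHomogeneous_of_mem_invAlg hn
          (homogeneousComponent_mem_invAlg f.2 d) hom h0
        have hk : k ≤ N := by
          have := Finset.mem_range.1 hd
          nlinarith [Nat.le_mul_of_pos_left k hn]
        have := ((colMinor_isHomogeneous (Fin.natAdd m)).pow (N - n * k / n)).mul hom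
        rw [Nat.mul_div_cancel_left _ hn] at this ⊢
        rwa [← mul_add, Nat.sub_add_cancel hk] at this
    · rw [hFval, map_sum]
      simp only [map_mul, map_pow, specialize_top hn, one_pow, one_mul]
      rw [← map_sum, MvPolynomial.sum_homogeneousComponent, hf]
  have hfF : f = -∑ d ∈ Finset.range (N + 1), (T ^ (N - d / n) - 1) * c d := by
    simp only [sub_mul, Finset.sum_sub_distrib, one_mul, ← hsum]
    rw [show ∑ d ∈ Finset.range (N + 1), T ^ (N - d / n) * c d = 0 from hF]
    simp
  rw [hfF]
  refine neg_mem (sum_mem fun d _ => Ideal.mul_mem_right _ _ (Ideal.mem_span_singleton.2 ?_))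
  simpa using sub_dvd_pow_sub_pow T 1 (N - d / n)

lemma specialize_pld_xi {n m : ℕ} {I J : List ℕ} (hIJ : isTab n m I J)
    (hK : memPl n (m + n) (xi n m I J)) :
    ∃ ε : ℂ, (ε = 1 ∨ ε = -1) ∧
      specialize n m (pld n m (xi n m I J)) = ε • dmin n m I J := by
  obtain ⟨hlen, -, hI, -, hIb, hJb⟩ := hIJ
  set U := (((List.range n).map (· + 1)).filter fun c => decide (c ∉ I)).reverse with hU
  have hxi : xi n m I J = J ++ U.map fun c => m + (n + 1 - c) := rfl
  have hINodup : I.Nodup := (List.isChain_iff_pairwise.1 hI).imp fun h => h.ne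
  have hUNodup : U.Nodup := by
    rw [hU, List.nodup_reverse]
    exact (List.nodup_range.map (add_left_injective 1)).filter _
  have hUb : ∀ c ∈ U, 1 ≤ c ∧ c ≤ n ∧ c ∉ I := by
    intro c hc
    simp only [hU, List.mem_reverse, List.mem_filter, List.mem_map, List.mem_range,
      decide_eq_true_eq] at hc
    obtain ⟨⟨a, ha, rfl⟩, h⟩ := hc
    exact ⟨by omega, by omega, h⟩
  have hcard : I.length + U.length = n := by
    have := hK.1
    rw [hxi, List.length_append, List.length_map] at this
    omega
  let κ (b : Fin n) : Fin (m + n) :=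
    ⟨(xi n m I J).getD b 0 - 1, by have := memPl_getD hK b; omega⟩
  have hκ (b : Fin n) : (xi n m I J).getD (b : ℕ) 0 = κ b + 1 :=
    (Nat.sub_add_cancel (memPl_getD hK b).1).symm
  let ecol : Fin I.length ⊕ Fin U.length ≃ Fin n := finSumFinEquiv.trans (finCongr hcard)
  let row : Fin I.length ⊕ Fin U.length → Fin n := Sum.elim
    (fun a => ⟨I[a] - 1, by have := hIb I[a] (List.getElem_mem _); omega⟩)
    (fun b => ⟨U[b] - 1, by have := hUb U[b] (List.getElem_mem _); omega⟩)
  have hrow : Function.Injective row := by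
    rintro (a | a) (b | b) hab
    · have ha := hIb I[a] (List.getElem_mem _)
      have hb := hIb I[b] (List.getElem_mem _)
      have h : I[a] - 1 = I[b] - 1 := congrArg Fin.val hab
      have h' : I[a] = I[b] := by omega
      exact congrArg _ (Fin.ext ((hINodup.getElem_inj_iff).1 h'))
    · have ha := hIb I[a] (List.getElem_mem _)
      have hb := hUb U[b] (List.getElem_mem _)
      have h : I[a] - 1 = U[b] - 1 := congrArg Fin.val hab
      have h' : I[a] = U[b] := by omega
      exact absurd (h' ▸ List.getElem_mem _) hb.2.2
    · have ha := hUb U[a] (List.getElem_mem _)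
      have hb := hIb I[b] (List.getElem_mem _)
      have h : U[a] - 1 = I[b] - 1 := congrArg Fin.val hab
      have h' : I[b] = U[a] := by omega
      exact absurd (h' ▸ List.getElem_mem _) ha.2.2
    · have ha := hUb U[a] (List.getElem_mem _)
      have hb := hUb U[b] (List.getElem_mem _)
      have h : U[a] - 1 = U[b] - 1 := congrArg Fin.val hab
      have h' : U[a] = U[b] := by omega
      exact congrArg _ (Fin.ext ((hUNodup.getElem_inj_iff).1 h'))
  let erow : Fin I.length ⊕ Fin U.length ≃ Fin n := Equiv.ofBijective row
    ((Fintype.bijective_iff_injective_and_card row).2 ⟨hrow, by simp [hcard]⟩)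
  have hcolI (b : Fin I.length) : ∃ h : J.getD (b : ℕ) 0 - 1 < m,
      κ (ecol (Sum.inl b)) = Fin.castAdd n ⟨J.getD (b : ℕ) 0 - 1, h⟩ := by
    have hb : (b : ℕ) < J.length := hlen ▸ b.2
    have hJ := hJb J[(b : ℕ)] (List.getElem_mem _)
    have hget : J.getD (b : ℕ) 0 = J[(b : ℕ)] := List.getD_eq_getElem _ _ hb
    refine ⟨by rw [hget]; omega, Fin.ext ?_⟩
    simp only [κ, ecol, hxi]
    simp [List.getElem?_append_left hb]
  have hcolU (b : Fin U.length) :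
      κ (ecol (Sum.inr b)) = Fin.natAdd m (row (Sum.inr b)).rev := by
    have hUb' := hUb U[b] (List.getElem_mem _)
    have h := hκ (ecol (Sum.inr b))
    have h2 : (xi n m I J).getD (ecol (Sum.inr b) : ℕ) 0 = m + (n + 1 - U[b]) := by
      simp [hxi, ecol, hlen]
    refine Fin.ext ?_
    simp only [row, Sum.elim_inr, Fin.val_natAdd, Fin.val_rev]
    omega
  set M : Matrix (Fin n) (Fin n) (MvPolynomial (Fin n × Fin m) ℂ) :=
    Matrix.of fun a b => augEntry n m (a, κ b) with hM
  have hblock : M.submatrix erow ecol = Matrix.fromBlocks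
      (M.submatrix (fun a => row (Sum.inl a)) (fun b => ecol (Sum.inl b))) 0
      (M.submatrix (fun a => row (Sum.inr a)) (fun b => ecol (Sum.inl b)))
      (Matrix.diagonal fun b =>
        MvPolynomial.C (antidiagEntry n (row (Sum.inr b)).rev)) := by
    ext1 a b
    rcases b with b | b
    · rcases a with a | a <;> rfl
    · have hentry : M.submatrix erow ecol a (Sum.inr b) =
          if a = Sum.inr b then
            MvPolynomial.C (antidiagEntry n (row (Sum.inr b)).rev) else 0 := by
        rw [Matrix.submatrix_apply, hM, Matrix.of_apply, hcolU, augEntry_natAdd, antidiag_apply,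
          Fin.rev_rev, apply_ite MvPolynomial.C, map_zero]
        exact if_congr hrow.eq_iff rfl rfl
      rw [hentry]
      rcases a with a | a <;> simp [Matrix.diagonal_apply]
      by_cases h : a = b <;> simp [h]
  have hminor : (M.submatrix (fun a => row (Sum.inl a)) (fun b => ecol (Sum.inl b))).det =
      dmin n m I J := by
    rw [dmin]
    congr 1
    ext1 a b
    obtain ⟨hJ, hcol⟩ := hcolI b
    have hIa := hIb I[a] (List.getElem_mem _)
    have hget : I.getD (a : ℕ) 0 = I[a] := List.getD_eq_getElem _ _ a.2
    rw [Matrix.submatrix_apply, hM, Matrix.of_apply, hcol, augEntry_castAdd, Matrix.of_apply,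
      dif_pos ⟨by rw [hget]; omega, hJ⟩]
    congr 2
    exact Fin.ext (by simp [row])
  obtain ⟨δ, hδ, hprod⟩ : ∃ δ : ℂ, (δ = 1 ∨ δ = -1) ∧
      ∏ b, antidiagEntry n (row (Sum.inr b)).rev = δ := by
    refine ⟨_, ?_, rfl⟩
    refine Finset.prod_induction _ (fun z : ℂ => z = 1 ∨ z = -1) ?_ (Or.inl rfl)
      fun b _ => antidiagEntry_eq_or _ _
    rintro x y (rfl | rfl) (rfl | rfl) <;> simp
  have hdet : (M.submatrix erow ecol).det = δ • dmin n m I J := by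
    rw [hblock, Matrix.det_fromBlocks_zero₁₂, hminor, Matrix.det_diagonal, ← map_prod, hprod,
      mul_comm, MvPolynomial.smul_eq_C_mul]
  have hperm : M.submatrix erow ecol =
      (M.submatrix (ecol.symm.trans erow) id).submatrix ecol ecol := by
    ext1 a b
    simp
  rw [hperm, Matrix.det_submatrix_equiv_self, Matrix.det_permute] at hdet
  rw [pld_eq_colMinor κ hκ, specialize_colMinor]
  rcases Int.units_eq_one_or (Equiv.Perm.sign (ecol.symm.trans erow)) with h | h
  · refine ⟨δ, hδ, ?_⟩
    simpa [h] using hdet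
  · refine ⟨-δ, by rcases hδ with rfl | rfl <;> simp, ?_⟩
    rw [neg_smul, ← hdet]
    simp [h, hM]

/-- Proposition `isom1`. The assignment `ξ̂(δ_K) = ±δ_{ξ⁻¹(K)}` (for
`K ≠ [m+1,…,m+n]`) and `ξ̂(δ_{[m+1,…,m+n]}) = 1` extends to a surjective ℂ-algebra
homomorphism from `ℂ[M_{n,m+n}]^{SLₙ}` onto `ℂ[M_{n,m}]` whose kernel is the ideal
generated by `δ_{[m+1,…,m+n]} − 1`; hence the quotient is isomorphic to `ℂ[M_{n,m}]`. -/
theorem invariant_ring_quotient_isom (n m : ℕ) (hn : 0 < n) (hm : 0 < m) :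
    ∃ (hinv : ∀ K : List ℕ, memPl n (m + n) K → pld n m K ∈ invAlg n (m + n))
      (φ : invAlg n (m + n) →ₐ[ℂ] MvPolynomial (Fin n × Fin m) ℂ),
      Function.Surjective φ ∧
      (∀ (K : List ℕ) (hK : memPl n (m + n) K),
        (K = topL n m → φ ⟨pld n m K, hinv K hK⟩ = 1) ∧
        ∀ I J : List ℕ, isTab n m I J → xi n m I J = K →
          ∃ ε : ℂ, (ε = 1 ∨ ε = -1) ∧ φ ⟨pld n m K, hinv K hK⟩ = ε • dmin n m I J) ∧
      RingHom.ker φ.toRingHom =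
        Ideal.span {x : invAlg n (m + n) |
          (x : MvPolynomial (Fin n × Fin (m + n)) ℂ) = pld n m (topL n m) - 1} ∧
      Nonempty ((invAlg n (m + n) ⧸ Ideal.span {x : invAlg n (m + n) |
          (x : MvPolynomial (Fin n × Fin (m + n)) ℂ) = pld n m (topL n m) - 1})
        ≃ₐ[ℂ] MvPolynomial (Fin n × Fin m) ℂ) := by
  have hsurj : Function.Surjective ((specialize n m).comp (invAlg n (m + n)).val) := by
    rw [← AlgHom.range_eq_top, eq_top_iff, ← MvPolynomial.adjoin_range_X, Algebra.adjoin_le_iff]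
    rintro _ ⟨⟨i, j⟩, rfl⟩
    obtain ⟨f, hf, hfX⟩ := exists_specialize_eq_X hn i j
    exact ⟨⟨f, hf⟩, hfX⟩
  let T : invAlg n (m + n) := ⟨pld n m (topL n m), pld_mem_invAlg (topL_memPl n m)⟩
  have hset : {x : invAlg n (m + n) |
      (x : MvPolynomial (Fin n × Fin (m + n)) ℂ) = pld n m (topL n m) - 1} = {T - 1} := by
    ext x
    exact (Subtype.ext_iff (a1 := x) (a2 := T - 1)).symm
  have hker : RingHom.ker ((specialize n m).comp (invAlg n (m + n)).val).toRingHom =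
      Ideal.span {x : invAlg n (m + n) |
        (x : MvPolynomial (Fin n × Fin (m + n)) ℂ) = pld n m (topL n m) - 1} := by
    rw [hset]
    refine le_antisymm (fun f hf => mem_span_of_specialize_eq_zero hn f T (pld_topL n m) hf) ?_
    rw [Ideal.span_singleton_le_iff_mem]
    change specialize n m (pld n m (topL n m) - 1) = 0
    rw [map_sub, pld_topL, specialize_top hn, map_one, sub_self]
  refine ⟨fun K hK => pld_mem_invAlg hK, (specialize n m).comp (invAlg n (m + n)).val, hsurj,
    fun K hK => ⟨?_, ?_⟩, hker, ?_⟩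
  · rintro rfl
    change specialize n m (pld n m (topL n m)) = 1
    rw [pld_topL, specialize_top hn]
  · rintro I J hIJ rfl
    exact specialize_pld_xi hIJ hK
  · rw [← hker]
    exact ⟨Ideal.quotientKerAlgEquivOfSurjective hsurj⟩

end
end

section
/- Let A, B ∈ D(n,m). In ℂ[M_{n,m}], the product δ_A δ_B can be expressed as a ℂ-linear combination δ_A δ_B = Σ_r c_r δ_{X_r} δ_{Y_r} of standard monomials such that for each r, either X_r ⪯ A∧B ⪯ A∨B ⪯ Y_r, or X_r ⪯ A∧B and the factor δ_{Y_r} is absent (equal to 1); moreover the term δ_{A∧B} δ_{A∨B} appears with coefficient 1. -/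
noncomputable section

def xiInvI (n m : ℕ) (K : List ℕ) : List ℕ :=
  ((List.range n).map (· + 1)).filter fun i => decide (m + (n + 1 - i) ∉ K)

def xiInvJ (m : ℕ) (K : List ℕ) : List ℕ := K.filter fun x => decide (x ≤ m)

/-- The meet `A ∧ B` in the distributive lattice `D(n,m)`, computed by transporting the
entrywise minimum through the order isomorphism ξ. -/
def tabMeet (n m : ℕ) (A B : List ℕ × List ℕ) : List ℕ × List ℕ :=
  (xiInvI n m (List.zipWith min (xi n m A.1 A.2) (xi n m B.1 B.2)),
    xiInvJ m (List.zipWith min (xi n m A.1 A.2) (xi n m B.1 B.2)))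

/-- The join `A ∨ B` in the distributive lattice `D(n,m)`. -/
def tabJoin (n m : ℕ) (A B : List ℕ × List ℕ) : List ℕ × List ℕ :=
  (xiInvI n m (List.zipWith max (xi n m A.1 A.2) (xi n m B.1 B.2)),
    xiInvJ m (List.zipWith max (xi n m A.1 A.2) (xi n m B.1 B.2)))

/-- The alternating map obtained from an alternating map by fixing the arguments outside a
predicate. -/
def AlternatingMap.fixArgs {R M N ι : Type*} [CommRing R] [AddCommGroup M] [Module R M]
    [AddCommGroup N] [Module R N] (f : M [⋀^ι]→ₗ[R] N) (P : ι → Prop) [DecidablePred P]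
    (z : ι → M) : M [⋀^{a // P a}]→ₗ[R] N :=
  { f.toMultilinearMap.domDomRestrict P (fun a => z a) with
    map_eq_zero_of_eq' := fun v i j hv hij => by
      refine f.map_eq_zero_of_eq _ (i := i) (j := j) ?_ (fun h => hij (Subtype.ext h))
      simp [i.2, j.2, hv] }

theorem AlternatingMap.fixArgs_apply {R M N ι : Type*} [CommRing R] [AddCommGroup M] [Module R M]
    [AddCommGroup N] [Module R N] (f : M [⋀^ι]→ₗ[R] N) (P : ι → Prop) [DecidablePred P]
    (z : ι → M) (v : {a // P a} → M) :
    f.fixArgs P z v = f (fun j => if h : P j then v ⟨j, h⟩ else z j) := rfl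

/-- The maximal minor of the matrix with columns `x a` picked out by the sequence `K`. -/
def maxMinor {n : ℕ} {α R : Type*} [CommRing R] (x : α → Fin n → R) (K : Fin n → α) : R :=
  Matrix.det (Matrix.of fun j => x (K j))

theorem maxMinor_comp_perm {n : ℕ} {α R : Type*} [CommRing R] (x : α → Fin n → R)
    (K : Fin n → α) (τ : Equiv.Perm (Fin n)) :
    maxMinor x (K ∘ τ) = (Equiv.Perm.sign τ : ℤ) * maxMinor x K := by
  exact Matrix.det_permute τ (Matrix.of fun j => x (K j))

theorem maxMinor_eq_zero {n : ℕ} {α R : Type*} [CommRing R] (x : α → Fin n → R)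
    (K : Fin n → α) (h : ¬ Function.Injective K) : maxMinor x K = 0 := by
  simp only [Function.Injective, not_forall] at h
  obtain ⟨a, b, hab, hne⟩ := h
  exact Matrix.det_zero_of_row_eq hne (congrArg x hab)

theorem exists_domCoprod_summand_one_eq_neg_sum {n : ℕ} {R ιa ιb : Type*} [CommRing R]
    [Fintype ιa] [Fintype ιb] [DecidableEq ιa] [DecidableEq ιb]
    (f : (Fin n → R) [⋀^ιa]→ₗ[R] R) (g : (Fin n → R) [⋀^ιb]→ₗ[R] R)
    (h : n < Fintype.card ιa + Fintype.card ιb) (v : ιa ⊕ ιb → Fin n → R) :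
    ∃ S : Finset (Equiv.Perm.ModSumCongr ιa ιb), (∀ q ∈ S, q ≠ Quotient.mk'' 1) ∧
      LinearMap.mul' R R (AlternatingMap.domCoprod.summand f g (Quotient.mk'' 1) v) =
        -∑ σ ∈ S, LinearMap.mul' R R (AlternatingMap.domCoprod.summand f g σ v) := by
  have h0 : f.domCoprod g = 0 := by
    refine Module.Basis.ext_alternating (Pi.basisFun R (Fin n)) fun w hw => ?_
    have := Fintype.card_le_of_injective w hw
    simp at this
    omega
  have h1 : f.domCoprod g v = 0 := by rw [h0]; rfl
  classical
  rw [AlternatingMap.domCoprod_apply, sum_apply] at h1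
  have h2 := (Finset.add_sum_erase _ _ (@Finset.mem_univ _ _ (Quotient.mk'' 1))).trans h1
  refine ⟨Finset.univ.erase (Quotient.mk'' 1), fun q hq => Finset.ne_of_mem_erase hq, ?_⟩
  rw [← map_sum, ← map_neg]
  exact congrArg _ (eq_neg_of_add_eq_zero_left (by convert h2))

/-- Sorting a sequence obtained from `K` by lowering entries past position `i` gives a sequence
which is entrywise at most `K`. -/
theorem le_of_exchange {ι α : Type*} [LinearOrder ι] [Fintype ι] [LinearOrder α]
    {K K' f : ι → α} {τ : Equiv.Perm ι} {i : ι} (hK : StrictMono K) (hK' : StrictMono K')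
    (hf : K' = f ∘ τ)
    (h1 : ∀ j < i, f j = K j)
    (h2 : ∀ j, i ≤ j → f j < K i ∨ ∃ j', f j = K j') : K' ≤ K := by
  intro j
  by_contra! hj
  have finj : Function.Injective f := by
    have : f = K' ∘ τ.symm := by rw [hf]; ext; simp
    rw [this]; exact hK'.injective.comp τ.symm.injective
  set S : Finset ι := Finset.univ.filter fun t => K j < f t with hS
  set T : Finset ι := Finset.univ.filter fun t => j < t with hT
  have hST : S.card ≤ T.card := by
    rcases lt_or_ge j i with hji | hij
    · apply Finset.card_le_card
      intro t ht
      simp only [hS, hT, Finset.mem_filter, Finset.mem_univ, true_and] at ht ⊢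
      by_contra! htj
      rw [h1 t (htj.trans_lt hji)] at ht
      exact absurd (hK.monotone htj) (not_le.2 ht)
    · rw [← Finset.card_image_of_injective S finj, ← Finset.card_image_of_injective T hK.injective]
      apply Finset.card_le_card
      intro a ha
      simp only [hS, hT, Finset.mem_image, Finset.mem_filter, Finset.mem_univ, true_and] at ha ⊢
      obtain ⟨t, ht, rfl⟩ := ha
      rcases lt_or_ge t i with hti | hit
      · rw [h1 t hti] at ht
        exact absurd (hK (hti.trans_le hij)) (not_lt.2 ht.le)
      · rcases h2 t hit with h | ⟨j', h⟩
        · exact absurd (hK.monotone hij) (not_le.2 (h.trans' ht))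
        · exact ⟨j', by rw [h] at ht; exact hK.lt_iff_lt.1 ht, h.symm⟩
  have hTS : (insert j T).card ≤ S.card := by
    rw [← Finset.card_image_of_injective (insert j T) τ.injective]
    apply Finset.card_le_card
    intro a ha
    simp only [hS, hT, Finset.mem_image, Finset.mem_insert, Finset.mem_filter, Finset.mem_univ,
      true_and] at ha ⊢
    obtain ⟨t, ht, rfl⟩ := ha
    have : K' t = f (τ t) := by rw [hf]; rfl
    rw [← this]
    refine hj.trans_le (hK'.monotone ?_)
    rcases ht with rfl | ht
    · exact le_rfl
    · exact ht.le
  rw [Finset.card_insert_of_notMem (by simp [hT])] at hTS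
  omega

theorem exists_perm_strictMono {n : ℕ} {α : Type*} [LinearOrder α] {f : Fin n → α}
    (hf : Function.Injective f) : ∃ τ : Equiv.Perm (Fin n), StrictMono (f ∘ τ) :=
  ⟨Tuple.sort f, (Tuple.monotone_sort f).strictMono_of_injective
    (hf.comp (Tuple.sort f).injective)⟩

/-- The standard products bounded below by `K` and above by `L`. -/
def boundedStd {n : ℕ} {α R : Type*} [LinearOrder α] [CommRing R] (x : α → Fin n → R)
    (K L : Fin n → α) : Set R :=
  {r | ∃ M N : Fin n → α, StrictMono M ∧ StrictMono N ∧ M ≤ N ∧ M ≤ K ∧ L ≤ N ∧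
    r = maxMinor x M * maxMinor x N}

theorem boundedStd_mono {n : ℕ} {α R : Type*} [LinearOrder α] [CommRing R] (x : α → Fin n → R)
    {K L K' L' : Fin n → α} (hK : K' ≤ K) (hL : L ≤ L') :
    boundedStd x K' L' ⊆ boundedStd x K L := by
  rintro r ⟨M, N, hM, hN, hMN, h1, h2, rfl⟩
  exact ⟨M, N, hM, hN, hMN, h1.trans hK, hL.trans h2, rfl⟩

theorem maxMinor_mul_mem_span {n : ℕ} {α R : Type*} [LinearOrder α] [Finite α] [CommRing R]
    [Algebra ℂ R] (x : α → Fin n → R) (K : Fin n → α) :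
    ∀ L : Fin n → α, StrictMono K → StrictMono L →
      maxMinor x K * maxMinor x L ∈ Submodule.span ℂ (boundedStd x K L) := by
  induction K using WellFoundedLT.induction with
  | _ K ih =>
  intro L hK hL
  by_cases hKL : K ≤ L
  · exact Submodule.subset_span ⟨K, L, hK, hL, hKL, le_rfl, le_rfl, rfl⟩
  obtain ⟨i, hi⟩ : ∃ i, L i < K i := by simpa [Pi.le_def] using hKL
  let D : (Fin n → R) [⋀^Fin n]→ₗ[R] R := Matrix.detRowAlternating
  let f := D.fixArgs (fun j => i ≤ j) (fun j => x (K j))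
  let g := D.fixArgs (fun j => j ≤ i) (fun j => x (L j))
  let w : {j // i ≤ j} ⊕ {j // j ≤ i} → α := Sum.elim (fun j => K j) (fun j => L j)
  have hcard : n < Fintype.card {j // i ≤ j} + Fintype.card {j // j ≤ i} := by
    have h1 : Fintype.card {j // i ≤ j} = n - i := by
      rw [Fintype.card_subtype, ← Fin.card_Ici]; congr 1; ext; simp
    have h2 : Fintype.card {j // j ≤ i} = i + 1 := by
      rw [Fintype.card_subtype, ← Fin.card_Iic]; congr 1; ext; simp
    omega
  obtain ⟨S, hS, hsum⟩ := exists_domCoprod_summand_one_eq_neg_sum f g hcard (fun t => x (w t))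
  let fK (σ : Equiv.Perm ({j // i ≤ j} ⊕ {j // j ≤ i})) : Fin n → α :=
    fun j => if h : i ≤ j then w (σ (Sum.inl ⟨j, h⟩)) else K j
  let fL (σ : Equiv.Perm ({j // i ≤ j} ⊕ {j // j ≤ i})) : Fin n → α :=
    fun j => if h : j ≤ i then w (σ (Sum.inr ⟨j, h⟩)) else L j
  have hterm : ∀ σ : Equiv.Perm ({j // i ≤ j} ⊕ {j // j ≤ i}),
      LinearMap.mul' R R (AlternatingMap.domCoprod.summand f g (Quotient.mk'' σ)
        (fun t => x (w t))) =
      ((Equiv.Perm.sign σ : ℤ) : ℂ) • (maxMinor x (fK σ) * maxMinor x (fL σ)) := by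
    intro σ
    have e1 : f (fun t => x (w (σ (Sum.inl t)))) = maxMinor x (fK σ) := by
      simp only [f, AlternatingMap.fixArgs_apply, maxMinor, D, fK]
      refine congrArg Matrix.det (funext fun j => ?_)
      change _ = x _
      split_ifs <;> rfl
    have e2 : g (fun t => x (w (σ (Sum.inr t)))) = maxMinor x (fL σ) := by
      simp only [g, AlternatingMap.fixArgs_apply, maxMinor, D, fL]
      refine congrArg Matrix.det (funext fun j => ?_)
      change _ = x _
      split_ifs <;> rfl
    rw [AlternatingMap.domCoprod.summand_mk'', ← e1, ← e2]
    rcases Int.units_eq_one_or (Equiv.Perm.sign σ) with h | h <;> simp [h]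
  have hone : fK 1 = K ∧ fL 1 = L := by
    constructor <;> ext j <;> simp [fK, fL, w]
  rw [hterm, hone.1, hone.2, Equiv.Perm.sign_one, Units.val_one, Int.cast_one, one_smul] at hsum
  rw [hsum]
  refine Submodule.neg_mem _ (Submodule.sum_mem _ fun q hq => ?_)
  induction q using Quotient.inductionOn' with
  | h σ =>
  rw [hterm]
  apply Submodule.smul_mem
  by_cases hfK : Function.Injective (fK σ)
  swap
  · rw [maxMinor_eq_zero x _ hfK, zero_mul]; exact Submodule.zero_mem _
  by_cases hfL : Function.Injective (fL σ)
  swap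
  · rw [maxMinor_eq_zero x _ hfL, mul_zero]; exact Submodule.zero_mem _
  obtain ⟨τ, hτ⟩ := exists_perm_strictMono hfK
  obtain ⟨ρ, hρ⟩ := exists_perm_strictMono hfL
  have hleK : fK σ ∘ τ ≤ K := by
    refine le_of_exchange (i := i) hK hτ rfl (fun j hj => by simp [fK, hj]) fun j hj => ?_
    simp only [fK, hj, dite_true]
    rcases σ (Sum.inl ⟨j, hj⟩) with t | t
    · exact Or.inr ⟨t, rfl⟩
    · exact Or.inl ((hL.monotone t.2).trans_lt hi)
  have hleL : L ≤ fL σ ∘ ρ := by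
    refine le_of_exchange (ι := (Fin n)ᵒᵈ) (α := αᵒᵈ) (K := L) (f := fL σ) (τ := ρ)
      (K' := fL σ ∘ ρ) (i := i) hL.dual hρ.dual rfl
      (fun j hj => ?_) fun j hj => ?_
    · have : ¬ (OrderDual.ofDual j ≤ i) := not_le.2 hj
      exact dif_neg this
    · have hj' : OrderDual.ofDual j ≤ i := hj
      have : fL σ j = w (σ (Sum.inr ⟨j, hj'⟩)) := dif_pos hj'
      rw [this]
      rcases σ (Sum.inr ⟨j, hj'⟩) with t | t
      · exact Or.inl (hi.trans_le (hK.monotone t.2))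
      · exact Or.inr ⟨(t : Fin n), rfl⟩
  have hne : fK σ ∘ τ ≠ K := by
    intro heq
    have hσ : σ ∉ (Equiv.Perm.sumCongrHom {j // i ≤ j} {j // j ≤ i}).range := by
      intro hmem
      apply hS _ hq
      refine Quotient.sound' ?_
      rw [QuotientGroup.leftRel_apply]
      simpa using hmem
    have hσ2 := mt Equiv.Perm.mem_sumCongrHom_range_of_perm_mapsTo_inl hσ
    simp only [Set.MapsTo, Set.mem_range, forall_exists_index, forall_apply_eq_imp_iff,
      not_forall] at hσ2
    obtain ⟨⟨j, hj⟩, h⟩ := hσ2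
    rcases h3 : σ (Sum.inl ⟨j, hj⟩) with t | t
    · exact h ⟨t, h3.symm⟩
    have hval : fK σ j = L t := by simp [fK, hj, h3, w]
    obtain ⟨s, hs⟩ : ∃ s, fK σ j = K s := ⟨τ.symm j, by rw [← heq]; simp⟩
    have hsi : s < i := by
      by_contra! his
      have := hL.monotone t.2
      have := hK.monotone his
      rw [hval] at hs
      exact absurd hi (not_lt.2 (by order))
    have : fK σ s = K s := by simp [fK, hsi]
    rw [← this] at hs
    exact absurd (hfK hs) (hsi.trans_le hj).ne'
  have key := ih _ (lt_of_le_of_ne hleK hne) (fL σ ∘ ρ) hτ hρ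
  have key2 := Submodule.span_mono (R := ℂ) (boundedStd_mono x hleK hleL) key
  rw [maxMinor_comp_perm, maxMinor_comp_perm] at key2
  rcases Int.units_eq_one_or (Equiv.Perm.sign τ) with h | h <;>
  rcases Int.units_eq_one_or (Equiv.Perm.sign ρ) with h₂ | h₂ <;> simpa [h, h₂] using key2

/-- The columns of the generic `n × N` matrix. -/
def genericCol (n N : ℕ) (k : Fin N) (a : Fin n) : MvPolynomial (Fin n × Fin N) ℂ :=
  MvPolynomial.X (a, k)

/-- The exponent of the product of the diagonal monomials of two sequences of columns. -/
def diagExp {n N : ℕ} (K L : Fin n → Fin N) : (Fin n × Fin N) →₀ ℕ :=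
  ∑ i, Finsupp.single (i, K i) 1 + ∑ i, Finsupp.single (i, L i) 1

/-- The weight on monomials giving `x i k` the weight `i * k`. -/
def mulWeight {n N : ℕ} (p : Fin n × Fin N) : ℕ := (p.1 : ℕ) * (p.2 : ℕ)

theorem weight_diagExp {n N : ℕ} (K L : Fin n → Fin N) :
    Finsupp.weight mulWeight (diagExp K L) =
      ∑ i : Fin n, (i : ℕ) * (K i : ℕ) + ∑ i : Fin n, (i : ℕ) * (L i : ℕ) := by
  simp [diagExp, mulWeight, map_sum, Finsupp.weight_single]

theorem sum_mul_comp_perm_le {n N : ℕ} {K : Fin n → Fin N} (hK : StrictMono K)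
    (σ : Equiv.Perm (Fin n)) :
    ∑ i : Fin n, (i : ℕ) * (K (σ i) : ℕ) ≤ ∑ i : Fin n, (i : ℕ) * (K i : ℕ) := by
  have hmono : Monovary (fun i : Fin n => (i : ℕ)) (fun i => (K i : ℕ)) :=
    fun a b hab => (hK.lt_iff_lt.1 hab).le
  simpa using hmono.sum_smul_comp_perm_le_sum_smul (σ := σ)

theorem perm_eq_one_of_sum_mul_le {n N : ℕ} {K : Fin n → Fin N} (hK : StrictMono K)
    (σ : Equiv.Perm (Fin n))
    (h : ∑ i : Fin n, (i : ℕ) * (K i : ℕ) ≤ ∑ i : Fin n, (i : ℕ) * (K (σ i) : ℕ)) : σ = 1 := by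
  have hmono : Monovary (fun i : Fin n => (i : ℕ)) (fun i => (K i : ℕ)) :=
    fun a b hab => (hK.lt_iff_lt.1 hab).le
  have h1 := (hmono.sum_smul_comp_perm_eq_sum_smul_iff (σ := σ)).1
    (by simpa using le_antisymm (sum_mul_comp_perm_le hK σ) h)
  have hσ : StrictMono σ := by
    refine Monotone.strictMono_of_injective (fun a b hab => ?_) σ.injective
    by_contra! hlt
    have h2 : (a : ℕ) ≥ b := by
      simpa using not_lt.1 fun hc : a < b => by
        have : b ≤ a := h1 (i := b) (j := a) (hK hlt)
        omega
    have : a = b := le_antisymm hab h2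
    exact absurd hlt (by rw [this]; exact lt_irrefl _)
  ext1 i
  exact congrFun hσ.eq_id i

theorem maxMinor_genericCol {n N : ℕ} (K : Fin n → Fin N) :
    maxMinor (genericCol n N) K = ∑ σ : Equiv.Perm (Fin n),
      MvPolynomial.monomial (∑ i, Finsupp.single (i, K (σ i)) 1) ((Equiv.Perm.sign σ : ℤ) : ℂ) := by
  rw [maxMinor, Matrix.det_apply']
  refine Finset.sum_congr rfl fun σ _ => ?_
  rw [← mul_one ((Equiv.Perm.sign σ : ℤ) : ℂ), ← MvPolynomial.C_mul_monomial,
    MvPolynomial.monomial_sum_one]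
  simp [genericCol, MvPolynomial.X]

theorem coeff_maxMinor_mul {n N : ℕ} {K L : Fin n → Fin N} (hK : StrictMono K)
    (hL : StrictMono L) (D : (Fin n × Fin N) →₀ ℕ)
    (hD : Finsupp.weight mulWeight (diagExp K L) ≤ Finsupp.weight mulWeight D) :
    MvPolynomial.coeff D (maxMinor (genericCol n N) K * maxMinor (genericCol n N) L) =
      if diagExp K L = D then 1 else 0 := by
  have hcoeff : MvPolynomial.coeff D
      (maxMinor (genericCol n N) K * maxMinor (genericCol n N) L) =
      ∑ σ : Equiv.Perm (Fin n), ∑ τ : Equiv.Perm (Fin n),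
        if diagExp (K ∘ σ) (L ∘ τ) = D then
          ((Equiv.Perm.sign σ : ℤ) : ℂ) * ((Equiv.Perm.sign τ : ℤ) : ℂ) else 0 := by
    simp only [maxMinor_genericCol, Finset.sum_mul_sum, MvPolynomial.coeff_sum,
      MvPolynomial.monomial_mul, MvPolynomial.coeff_monomial]
    rfl
  have hone : ∀ σ τ : Equiv.Perm (Fin n), diagExp (K ∘ σ) (L ∘ τ) = D → σ = 1 ∧ τ = 1 := by
    rintro σ τ rfl
    simp only [weight_diagExp, Function.comp] at hD
    have h1 := sum_mul_comp_perm_le hK σ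
    have h2 := sum_mul_comp_perm_le hL τ
    exact ⟨perm_eq_one_of_sum_mul_le hK σ (by omega), perm_eq_one_of_sum_mul_le hL τ (by omega)⟩
  rw [hcoeff, Finset.sum_eq_single 1, Finset.sum_eq_single 1]
  · simp
  · intro τ _ hτ
    exact if_neg fun h => hτ (hone _ _ h).2
  · simp
  · intro σ _ hσ
    exact Finset.sum_eq_zero fun τ _ => if_neg fun h => hσ (hone _ _ h).1
  · simp

theorem diagExp_apply {n N : ℕ} (K L : Fin n → Fin N) (i : Fin n) (k : Fin N) :
    diagExp K L (i, k) = (if K i = k then 1 else 0) + if L i = k then 1 else 0 := by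
  have h : ∀ K : Fin n → Fin N, (∑ j, Finsupp.single (j, K j) 1 : (Fin n × Fin N) →₀ ℕ) (i, k) =
      if K i = k then 1 else 0 := by
    intro K
    rw [Finsupp.finsetSum_apply, Finset.sum_eq_single i]
    · simp [Finsupp.single_apply]
    · intro j _ hj
      simp [hj]
    · simp
  rw [diagExp, Finsupp.add_apply, h, h]

theorem diagExp_injective {n N : ℕ} {K L K' L' : Fin n → Fin N} (h : K ≤ L) (h' : K' ≤ L')
    (hD : diagExp K L = diagExp K' L') : K = K' ∧ L = L' := by
  have key : ∀ i, K i = K' i ∧ L i = L' i := by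
    intro i
    have h0 := h i
    have h0' := h' i
    have e : ∀ k, _ := fun k => congrArg (fun D => D (i, k)) hD
    simp only [diagExp_apply] at e
    have e1 := e (K i)
    have e2 := e (L i)
    have e3 := e (K' i)
    have e4 := e (L' i)
    grind
  exact ⟨funext fun i => (key i).1, funext fun i => (key i).2⟩

theorem diagExp_inf_sup {n N : ℕ} (K L : Fin n → Fin N) :
    diagExp (K ⊓ L) (K ⊔ L) = diagExp K L := by
  ext ⟨i, k⟩
  simp only [diagExp_apply, Pi.inf_apply, Pi.sup_apply]
  rcases le_total (K i) (L i) with h | h <;> simp [h, add_comm]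

/-- Pairs of comparable strictly increasing sequences. -/
abbrev StdPair (n N : ℕ) :=
  {p : (Fin n → Fin N) × (Fin n → Fin N) // StrictMono p.1 ∧ StrictMono p.2 ∧ p.1 ≤ p.2}

instance (n N : ℕ) : Fintype (StdPair n N) := Fintype.ofFinite _

/-- The standard product of maximal minors attached to a pair. -/
def StdPair.prod {n N : ℕ} (s : StdPair n N) : MvPolynomial (Fin n × Fin N) ℂ :=
  maxMinor (genericCol n N) s.1.1 * maxMinor (genericCol n N) s.1.2

/-- The diagonal exponent of a pair. -/
def StdPair.exp {n N : ℕ} (s : StdPair n N) : (Fin n × Fin N) →₀ ℕ := diagExp s.1.1 s.1.2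

theorem StdPair.exp_injective {n N : ℕ} : Function.Injective (StdPair.exp (n := n) (N := N)) := by
  rintro ⟨⟨K, L⟩, _, _, h⟩ ⟨⟨K', L'⟩, _, _, h'⟩ e
  obtain ⟨rfl, rfl⟩ := diagExp_injective h h' e
  rfl

theorem coeff_sum_stdPair {n N : ℕ} (c : StdPair n N → ℂ) (t : StdPair n N)
    (h : ∀ s, c s ≠ 0 → Finsupp.weight mulWeight s.exp ≤ Finsupp.weight mulWeight t.exp) :
    MvPolynomial.coeff t.exp (∑ s, c s • s.prod) = c t := by
  rw [MvPolynomial.coeff_sum, Finset.sum_eq_single t]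
  · rw [MvPolynomial.coeff_smul, StdPair.prod, StdPair.exp,
      coeff_maxMinor_mul t.2.1 t.2.2.1 _ le_rfl]
    simp
  · intro s _ hst
    by_cases hs : c s = 0
    · simp [hs]
    rw [MvPolynomial.coeff_smul, StdPair.prod, coeff_maxMinor_mul s.2.1 s.2.2.1 _ (h s hs)]
    exact (congrArg _ (if_neg fun e => hst (StdPair.exp_injective e))).trans (smul_zero _)
  · simp

theorem weight_le_of_sum_eq {n N : ℕ} (c : StdPair n N → ℂ) (a : ℂ) {K L : Fin n → Fin N}
    (hK : StrictMono K) (hL : StrictMono L)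
    (h : ∑ s, c s • s.prod =
      a • (maxMinor (genericCol n N) K * maxMinor (genericCol n N) L)) (s : StdPair n N)
    (hs : c s ≠ 0) :
    a ≠ 0 ∧ Finsupp.weight mulWeight s.exp ≤ Finsupp.weight mulWeight (diagExp K L) := by
  obtain ⟨t, ht, hmax⟩ := Finset.exists_max_image (Finset.univ.filter fun s => c s ≠ 0)
    (fun s => Finsupp.weight mulWeight s.exp) ⟨s, by simpa using hs⟩
  simp only [Finset.mem_filter, Finset.mem_univ, true_and] at ht hmax
  have h1 := coeff_sum_stdPair c t hmax
  rw [h, MvPolynomial.coeff_smul] at h1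
  have ha : a ≠ 0 := by
    rintro rfl
    exact ht (by simpa using h1.symm)
  refine ⟨ha, (hmax s hs).trans ?_⟩
  by_contra! hlt
  rw [coeff_maxMinor_mul hK hL _ hlt.le, if_neg fun e => hlt.ne (by rw [e]), smul_zero] at h1
  exact ht h1.symm

theorem coeff_inf_sup_of_sum_eq {n N : ℕ} (c : StdPair n N → ℂ) {K L : Fin n → Fin N}
    (hK : StrictMono K) (hL : StrictMono L)
    (h : ∑ s, c s • s.prod = maxMinor (genericCol n N) K * maxMinor (genericCol n N) L)
    (s : StdPair n N) (hs : s.1 = (K ⊓ L, K ⊔ L)) : c s = 1 := by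
  have hexp : s.exp = diagExp K L := by rw [StdPair.exp, hs, diagExp_inf_sup]
  have h1 := coeff_sum_stdPair c s fun t ht => by
    rw [hexp]
    exact (weight_le_of_sum_eq c 1 hK hL (by rw [h, one_smul]) t ht).2
  rw [← h1, h, coeff_maxMinor_mul hK hL _ (by rw [hexp]), if_pos hexp.symm]

theorem exists_stdPair_of_mem_span {n N : ℕ} {K L : Fin n → Fin N}
    {r : MvPolynomial (Fin n × Fin N) ℂ}
    (h : r ∈ Submodule.span ℂ (boundedStd (genericCol n N) K L)) :
    ∃ c : StdPair n N → ℂ, (∀ s, c s ≠ 0 → s.1.1 ≤ K ∧ L ≤ s.1.2) ∧ ∑ s, c s • s.prod = r := by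
  induction h using Submodule.span_induction with
  | mem r hr =>
    obtain ⟨M, M', hM, hM', hle, h1, h2, rfl⟩ := hr
    classical
    refine ⟨Pi.single ⟨(M, M'), hM, hM', hle⟩ 1, fun s hs => ?_, ?_⟩
    · obtain rfl : s = ⟨(M, M'), hM, hM', hle⟩ := by
        by_contra hne
        exact hs (Pi.single_eq_of_ne hne _)
      exact ⟨h1, h2⟩
    · rw [Finset.sum_eq_single ⟨(M, M'), hM, hM', hle⟩]
      · simp [StdPair.prod]
      · intro s _ hs
        simp [Pi.single_eq_of_ne hs]
      · simp
  | zero => exact ⟨0, by simp, by simp⟩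
  | add x y _ _ hr hr' =>
    obtain ⟨c, hc, rfl⟩ := hr
    obtain ⟨c', hc', rfl⟩ := hr'
    refine ⟨c + c', fun s hs => ?_, by simp [add_smul, Finset.sum_add_distrib]⟩
    by_cases h : c s = 0
    · exact hc' s fun h' => hs (by simp [h, h'])
    · exact hc s h
  | smul a x _ hr =>
    obtain ⟨c, hc, rfl⟩ := hr
    refine ⟨a • c, fun s hs => hc s fun h' => hs (by simp [h']), ?_⟩
    simp [Finset.smul_sum, mul_smul]

theorem exists_straightening {n N : ℕ} {K L : Fin n → Fin N}
    (hK : StrictMono K) (hL : StrictMono L) :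
    ∃ c : StdPair n N → ℂ, (∀ s, c s ≠ 0 → s.1.1 ≤ K ⊓ L ∧ K ⊔ L ≤ s.1.2) ∧
      ∑ s, c s • s.prod = maxMinor (genericCol n N) K * maxMinor (genericCol n N) L ∧
      ∀ s : StdPair n N, s.1 = (K ⊓ L, K ⊔ L) → c s = 1 := by
  obtain ⟨c, hc, hcsum⟩ := exists_stdPair_of_mem_span
    (maxMinor_mul_mem_span (genericCol n N) K L hK hL)
  obtain ⟨d, hd, hdsum⟩ := exists_stdPair_of_mem_span
    (maxMinor_mul_mem_span (genericCol n N) L K hL hK)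
  have hcd : c = d := by
    by_contra hne
    obtain ⟨s, hs⟩ := Function.ne_iff.1 hne
    refine (weight_le_of_sum_eq (c - d) 0 hK hL ?_ s (sub_ne_zero.2 hs)).1 rfl
    simp only [Pi.sub_apply, sub_smul, Finset.sum_sub_distrib, hcsum, hdsum]
    rw [mul_comm]; simp
  refine ⟨c, fun s hs => ?_, hcsum, coeff_inf_sup_of_sum_eq c hK hL hcsum⟩
  have h1 := hc s hs
  have h2 := hd s (hcd ▸ hs)
  exact ⟨le_inf h1.1 h2.1, sup_le h2.2 h1.2⟩

theorem det_append_single {R : Type*} [CommRing R] {h : ℕ} : ∀ (q : ℕ)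
    (u : Fin h → Fin (h + q) → R) (I : Fin h → Fin (h + q)) (C : Fin q → Fin (h + q)),
    StrictMono I → StrictAnti C → (∀ a b, I a ≠ C b) →
    Matrix.det (Matrix.of (Fin.append u
      (fun b => Pi.single (C b) ((-1) ^ ((C b : ℕ) + (h + q) + 1))))) =
      Matrix.det (Matrix.of fun a b => u a (I b)) := by
  intro q
  induction q with
  | zero =>
    intro u I C hI _ _
    have hI' : I = id := StrictMono.eq_id (f := (I : Fin h → Fin h)) hI
    congr 1
    ext a b
    subst hI'
    exact congrFun (Fin.append_left u
      (fun b : Fin 0 => Pi.single (C b) ((-1) ^ ((C b : ℕ) + (h + 0) + 1))) a) b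
  | succ q ih =>
    intro u I C hI hC hIC
    set c : Fin (h + q + 1) := C (Fin.last q) with hc
    choose I' hI' using fun a => Fin.exists_succAbove_eq (hIC a (Fin.last q))
    choose C' hC' using fun b : Fin q =>
      Fin.exists_succAbove_eq (hC.injective.ne (Fin.castSucc_lt_last b).ne)
    have hmono := Fin.strictMono_succAbove c
    have hval : ∀ b, (C b.castSucc : ℕ) = C' b + 1 := by
      intro b
      have h1 : c < C b.castSucc := hC (Fin.castSucc_lt_last b)
      rw [← hC' b] at h1 ⊢
      rw [Fin.lt_succAbove_iff_le_castSucc] at h1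
      rw [Fin.succAbove_of_le_castSucc _ _ h1]
      simp
    rw [Matrix.det_succ_row _ (Fin.last (h + q)), Finset.sum_eq_single c]
    · have hlast : ∀ (v : Fin (q + 1) → Fin (h + q + 1) → R),
          Fin.append u v (Fin.last (h + q)) = v (Fin.last q) :=
        fun v => Fin.append_right u v (Fin.last q)
      have ih' := ih (fun a k => u a (c.succAbove k)) I' C'
        (fun a b hab => by
          have := hI hab
          rw [← hI' a, ← hI' b] at this
          exact hmono.lt_iff_lt.1 this)
        (fun a b hab => by
          have := hC (Fin.castSucc_lt_castSucc_iff.2 hab)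
          rw [← hC' a, ← hC' b] at this
          exact hmono.lt_iff_lt.1 this)
        (fun a b e => hIC a b.castSucc (by rw [← hI' a, ← hC' b, e]))
      have hminor : Matrix.det (Matrix.of fun a b => u a (c.succAbove (I' b))) =
          Matrix.det (Matrix.of fun a b => u a (I b)) := by
        congr 1
        ext a b
        exact congrArg (u a) (hI' b)
      refine Eq.trans ?_ (ih'.trans hminor)
      have hsub : ∀ M N : Matrix (Fin (h + q)) (Fin (h + q)) R, M = N → ∀ s : R, s = 1 →
          s * M.det = N.det := by
        rintro M _ rfl s rfl
        exact one_mul _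
      refine hsub _ _ ?_ _ ?_
      · ext j k
        refine Fin.addCases (fun a => ?_) (fun b => ?_) j
        · simp only [Matrix.submatrix_apply, Matrix.of_apply, Fin.succAbove_last, Fin.append_left]
          exact congrFun (Fin.append_left u _ a) _
        · simp only [Matrix.submatrix_apply, Matrix.of_apply, Fin.succAbove_last, Fin.append_right]
          refine (congrFun (Fin.append_right u _ b.castSucc) _).trans ?_
          have hiff : c.succAbove k = C b.castSucc ↔ k = C' b := by
            rw [← hC', hmono.injective.eq_iff]
          rw [Pi.single_apply, Pi.single_apply, hval]
          refine (if_congr hiff rfl rfl).trans ?_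
          split_ifs with hk
          · ring
          · rfl
      · have hentry := congrFun (hlast fun b =>
          Pi.single (C b) ((-1) ^ ((C b : ℕ) + (h + (q + 1)) + 1))) c
        refine (congrArg ((-1) ^ (((Fin.last (h + q) : Fin (h + q + 1)) : ℕ) + (c : ℕ)) * ·)
          (hentry.trans (Pi.single_eq_same _ _))).trans ?_
        rw [Fin.val_last, ← pow_add]
        exact Even.neg_one_pow ⟨h + q + c + 1, by ring⟩
    · intro k _ hk
      have hlast : ∀ (v : Fin (q + 1) → Fin (h + q + 1) → R),
          Fin.append u v (Fin.last (h + q)) = v (Fin.last q) :=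
        fun v => Fin.append_right u v (Fin.last q)
      simp only [Matrix.of_apply, hlast, ← hc, Pi.single_eq_of_ne hk, mul_zero, zero_mul]
    · simp

/-- The tableau condition of `isTab`, allowing the empty tableau. -/
structure IsWeakTab (n m : ℕ) (I J : List ℕ) : Prop where
  length_eq : I.length = J.length
  left_lt : I.Pairwise (· < ·)
  right_lt : J.Pairwise (· < ·)
  left_mem : ∀ x ∈ I, 1 ≤ x ∧ x ≤ n
  right_mem : ∀ x ∈ J, 1 ≤ x ∧ x ≤ m

theorem isTab_iff {n m : ℕ} {I J : List ℕ} : isTab n m I J ↔ IsWeakTab n m I J ∧ I ≠ [] := by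
  constructor
  · rintro ⟨h1, h2, h3, h4, h5, h6⟩
    exact ⟨⟨h1, List.isChain_iff_pairwise.1 h3, List.isChain_iff_pairwise.1 h4, h5, h6⟩, h2⟩
  · rintro ⟨⟨h1, h3, h4, h5, h6⟩, h2⟩
    exact ⟨h1, h2, List.isChain_iff_pairwise.2 h3, List.isChain_iff_pairwise.2 h4, h5, h6⟩

theorem pairwise_lt_map_succ_range (n : ℕ) : ((List.range n).map (· + 1)).Pairwise (· < ·) := by
  rw [List.pairwise_map]
  exact List.pairwise_lt_range.imp fun h => Nat.succ_lt_succ h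

theorem mem_map_succ_range {n x : ℕ} : x ∈ (List.range n).map (· + 1) ↔ 1 ≤ x ∧ x ≤ n := by
  simp only [List.mem_map, List.mem_range]
  exact ⟨by rintro ⟨a, ha, rfl⟩; omega, fun h => ⟨x - 1, by omega, by omega⟩⟩

theorem filter_mem_map_succ_range {n : ℕ} {I : List ℕ} (hI : I.Pairwise (· < ·))
    (hmem : ∀ x ∈ I, 1 ≤ x ∧ x ≤ n) :
    ((List.range n).map (· + 1)).filter (fun c => decide (c ∈ I)) = I := by
  refine List.Pairwise.eq_of_mem_iff ((pairwise_lt_map_succ_range n).filter _) hI fun a => ?_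
  rw [List.mem_filter, mem_map_succ_range, decide_eq_true_iff]
  exact ⟨fun h => h.2, fun h => ⟨hmem a h, h⟩⟩

/-- The complement of `I` in `{1, …, n}`, in decreasing order. -/
def complDesc (n : ℕ) (I : List ℕ) : List ℕ :=
  (((List.range n).map (· + 1)).filter fun c => decide (c ∉ I)).reverse

theorem xi_eq_append (n m : ℕ) (I J : List ℕ) :
    xi n m I J = J ++ (complDesc n I).map fun c => m + (n + 1 - c) := rfl

theorem mem_complDesc {n x : ℕ} {I : List ℕ} :
    x ∈ complDesc n I ↔ (1 ≤ x ∧ x ≤ n) ∧ x ∉ I := by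
  rw [complDesc, List.mem_reverse, List.mem_filter, mem_map_succ_range, decide_eq_true_iff]

theorem pairwise_complDesc (n : ℕ) (I : List ℕ) : (complDesc n I).Pairwise (· > ·) :=
  List.pairwise_reverse.2 ((pairwise_lt_map_succ_range n).filter _)

theorem countP_complDesc_add {n : ℕ} {I : List ℕ} (hI : I.Pairwise (· < ·))
    (hmem : ∀ x ∈ I, 1 ≤ x ∧ x ≤ n) (p : ℕ → Bool) :
    (complDesc n I).countP p + I.countP p = ((List.range n).map (· + 1)).countP p := by
  rw [List.countP_eq_countP_filter_add ((List.range n).map (· + 1)) p fun c => decide (c ∈ I),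
    filter_mem_map_succ_range hI hmem, complDesc, List.countP_reverse, add_comm]
  simp only [decide_not]

theorem length_complDesc_add {n : ℕ} {I : List ℕ} (hI : I.Pairwise (· < ·))
    (hmem : ∀ x ∈ I, 1 ≤ x ∧ x ≤ n) : (complDesc n I).length + I.length = n := by
  simpa using countP_complDesc_add hI hmem fun _ => true

theorem pairwise_xi {n m : ℕ} {I J : List ℕ} (h : IsWeakTab n m I J) :
    (xi n m I J).Pairwise (· < ·) := by
  rw [xi_eq_append, List.pairwise_append, List.pairwise_map]
  refine ⟨h.right_lt, (pairwise_complDesc n I).imp_of_mem fun {a b} ha hb hab => ?_, ?_⟩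
  · have h1 := (mem_complDesc.1 ha).1
    have h2 := (mem_complDesc.1 hb).1
    omega
  · intro a ha b hb
    obtain ⟨c, hc, rfl⟩ := List.mem_map.1 hb
    have h1 := (mem_complDesc.1 hc).1
    have h2 := h.right_mem a ha
    omega

theorem length_xi {n m : ℕ} {I J : List ℕ} (h : IsWeakTab n m I J) : (xi n m I J).length = n := by
  rw [xi_eq_append, List.length_append, List.length_map, ← h.length_eq, add_comm]
  exact length_complDesc_add h.left_lt h.left_mem

theorem mem_xi {n m x : ℕ} {I J : List ℕ} :
    x ∈ xi n m I J ↔ x ∈ J ∨ ∃ c, ((1 ≤ c ∧ c ≤ n) ∧ c ∉ I) ∧ m + (n + 1 - c) = x := by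
  simp only [xi_eq_append, List.mem_append, List.mem_map, mem_complDesc]

/-- A sequence of column indices as a list of positive integers. -/
def seqList {n N : ℕ} (K : Fin n → Fin N) : List ℕ := List.ofFn fun j => (K j : ℕ) + 1

theorem length_seqList {n N : ℕ} (K : Fin n → Fin N) : (seqList K).length = n :=
  List.length_ofFn

theorem getElem_seqList {n N : ℕ} (K : Fin n → Fin N) {j : ℕ} (hj : j < n) :
    (seqList K)[j]'((length_seqList K).symm ▸ hj) = (K ⟨j, hj⟩ : ℕ) + 1 := by
  simp [seqList]

theorem mem_seqList {n N x : ℕ} {K : Fin n → Fin N} :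
    x ∈ seqList K ↔ ∃ j, (K j : ℕ) + 1 = x := by
  rw [seqList, List.mem_ofFn]

theorem pairwise_seqList {n N : ℕ} {K : Fin n → Fin N} (hK : StrictMono K) :
    (seqList K).Pairwise (· < ·) :=
  List.pairwise_ofFn.2 fun _ _ hij => Nat.succ_lt_succ (hK hij)

theorem seqList_injective {n N : ℕ} : Function.Injective (seqList : (Fin n → Fin N) → List ℕ) := by
  intro K L h
  funext j
  have := congrFun (List.ofFn_injective h) j
  exact Fin.ext (by simpa using this)

theorem exists_xi_eq_seqList {n m : ℕ} {I J : List ℕ} (h : IsWeakTab n m I J) :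
    ∃ K : Fin n → Fin (m + n), StrictMono K ∧ xi n m I J = seqList K := by
  have hlen := length_xi h
  have hmem : ∀ x ∈ xi n m I J, 1 ≤ x ∧ x ≤ m + n := by
    intro x hx
    rcases mem_xi.1 hx with hx | ⟨c, ⟨hc, -⟩, rfl⟩
    · have := h.right_mem x hx
      omega
    · omega
  have hget : ∀ j : Fin n, 1 ≤ (xi n m I J)[(j : ℕ)] ∧ (xi n m I J)[(j : ℕ)] ≤ m + n :=
    fun j => hmem _ (List.getElem_mem _)
  refine ⟨fun j => ⟨(xi n m I J)[(j : ℕ)] - 1, by have := hget j; omega⟩, ?_, ?_⟩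
  · intro i j hij
    have h1 := List.pairwise_iff_getElem.1 (pairwise_xi h) i j (by omega) (by omega) hij
    have h2 := hget i
    rw [Fin.mk_lt_mk]
    omega
  · refine List.ext_getElem (hlen.trans (length_seqList _).symm) fun j h1 h2 => ?_
    have := hget ⟨j, hlen ▸ h1⟩
    rw [getElem_seqList _ (hlen ▸ h1)]
    dsimp only at this ⊢
    omega

/-- The possibly empty tableau corresponding to a sequence of column indices. -/
def tabOf (n m : ℕ) (K : Fin n → Fin (m + n)) : List ℕ × List ℕ :=
  (xiInvI n m (seqList K), xiInvJ m (seqList K))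

section tabOf

variable {n m : ℕ} {K : Fin n → Fin (m + n)}

theorem mem_tabOf_fst {x : ℕ} :
    x ∈ (tabOf n m K).1 ↔ (1 ≤ x ∧ x ≤ n) ∧ m + (n + 1 - x) ∉ seqList K := by
  rw [tabOf, xiInvI, List.mem_filter, mem_map_succ_range, decide_eq_true_iff]

theorem mem_tabOf_snd {x : ℕ} : x ∈ (tabOf n m K).2 ↔ x ∈ seqList K ∧ x ≤ m := by
  rw [tabOf, xiInvJ, List.mem_filter, decide_eq_true_iff]

theorem pairwise_tabOf_fst : (tabOf n m K).1.Pairwise (· < ·) :=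
  (pairwise_lt_map_succ_range n).filter _

theorem xi_tabOf (hK : StrictMono K) : xi n m (tabOf n m K).1 (tabOf n m K).2 = seqList K := by
  refine List.Pairwise.eq_of_mem_iff (r := (· < ·)) ?_ (pairwise_seqList hK) fun x => ?_
  · rw [xi_eq_append, List.pairwise_append, List.pairwise_map]
    refine ⟨(pairwise_seqList hK).filter _,
      (pairwise_complDesc n _).imp_of_mem fun {a b} ha hb hab => ?_, ?_⟩
    · have h1 := (mem_complDesc.1 ha).1
      have h2 := (mem_complDesc.1 hb).1
      omega
    · intro a ha b hb
      obtain ⟨c, hc, rfl⟩ := List.mem_map.1 hb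
      have h1 := (mem_complDesc.1 hc).1
      have h2 := (mem_tabOf_snd.1 ha).2
      omega
  · rw [mem_xi, mem_tabOf_snd]
    constructor
    · rintro (h | ⟨c, ⟨hc, hc'⟩, rfl⟩)
      · exact h.1
      · by_contra hx
        exact hc' (mem_tabOf_fst.2 ⟨hc, hx⟩)
    · intro hx
      by_cases hxm : x ≤ m
      · exact Or.inl ⟨hx, hxm⟩
      · obtain ⟨j, hj⟩ := mem_seqList.1 hx
        have hlt := (K j).isLt
        have hx' : m + (n + 1 - (m + n + 1 - x)) = x := by omega
        refine Or.inr ⟨m + n + 1 - x, ⟨by omega, fun h => ?_⟩, hx'⟩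
        exact (mem_tabOf_fst.1 h).2 (hx'.symm ▸ hx)

theorem isWeakTab_tabOf (hK : StrictMono K) : IsWeakTab n m (tabOf n m K).1 (tabOf n m K).2 := by
  have hmem : ∀ x ∈ (tabOf n m K).1, 1 ≤ x ∧ x ≤ n := fun x hx => (mem_tabOf_fst.1 hx).1
  refine ⟨?_, pairwise_tabOf_fst, (pairwise_seqList hK).filter _, hmem, fun x hx => ?_⟩
  · have h1 := congrArg List.length (xi_tabOf hK)
    rw [xi_eq_append, List.length_append, List.length_map, length_seqList] at h1
    have h2 := length_complDesc_add pairwise_tabOf_fst hmem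
    omega
  · obtain ⟨hx, hxm⟩ := mem_tabOf_snd.1 hx
    obtain ⟨j, rfl⟩ := mem_seqList.1 hx
    exact ⟨Nat.succ_pos _, hxm⟩

theorem tabOf_injective {L : Fin n → Fin (m + n)} (hK : StrictMono K) (hL : StrictMono L)
    (h : tabOf n m K = tabOf n m L) : K = L := by
  apply seqList_injective
  rw [← xi_tabOf hK, ← xi_tabOf hL, h]

theorem tabOf_snd_eq_nil_iff (hn : 0 < n) (hK : StrictMono K) :
    (tabOf n m K).2 = [] ↔ m ≤ K ⟨0, hn⟩ := by
  rw [List.eq_nil_iff_forall_not_mem]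
  constructor
  · intro h
    by_contra hlt
    exact h _ (mem_tabOf_snd.2 ⟨mem_seqList.2 ⟨⟨0, hn⟩, rfl⟩, by omega⟩)
  · intro h x hx
    obtain ⟨hx, hxm⟩ := mem_tabOf_snd.1 hx
    obtain ⟨j, rfl⟩ := mem_seqList.1 hx
    have : K ⟨0, hn⟩ ≤ K j := hK.monotone (Fin.mk_le_of_le_val (Nat.zero_le _))
    have : (K ⟨0, hn⟩ : ℕ) ≤ K j := this
    omega

theorem tabOf_eq_nil (hn : 0 < n) (hK : StrictMono K) (h : m ≤ K ⟨0, hn⟩) :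
    tabOf n m K = ([], []) := by
  have h2 := (tabOf_snd_eq_nil_iff hn hK).2 h
  have h1 := (isWeakTab_tabOf hK).length_eq
  rw [h2, List.length_nil, List.length_eq_zero_iff] at h1
  exact Prod.ext h1 h2

theorem isTab_tabOf (hn : 0 < n) (hK : StrictMono K) (h : (K ⟨0, hn⟩ : ℕ) < m) :
    isTab n m (tabOf n m K).1 (tabOf n m K).2 := by
  refine isTab_iff.2 ⟨isWeakTab_tabOf hK, fun h1 => ?_⟩
  have h2 := (isWeakTab_tabOf hK).length_eq
  rw [h1, List.length_nil, eq_comm, List.length_eq_zero_iff, tabOf_snd_eq_nil_iff hn hK] at h2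
  omega

end tabOf

theorem zipWith_seqList {n N : ℕ} (f : ℕ → ℕ → ℕ) (g : Fin N → Fin N → Fin N)
    (hfg : ∀ a b : Fin N, f ((a : ℕ) + 1) ((b : ℕ) + 1) = (g a b : ℕ) + 1) (K L : Fin n → Fin N) :
    List.zipWith f (seqList K) (seqList L) = seqList fun j => g (K j) (L j) := by
  refine List.ext_getElem (by simp [length_seqList]) fun j h1 h2 => ?_
  have hj : j < n := by rwa [length_seqList] at h2
  rw [List.getElem_zipWith, getElem_seqList K hj, getElem_seqList L hj, getElem_seqList _ hj, hfg]

theorem tabMeet_eq_tabOf {n m : ℕ} {A B : List ℕ × List ℕ} {K L : Fin n → Fin (m + n)}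
    (hK : xi n m A.1 A.2 = seqList K) (hL : xi n m B.1 B.2 = seqList L) :
    tabMeet n m A B = tabOf n m (K ⊓ L) := by
  have h := zipWith_seqList min min (fun a b => by
    rcases le_total a b with h | h
    · rw [min_eq_left h, min_eq_left (Nat.succ_le_succ h)]
    · rw [min_eq_right h, min_eq_right (Nat.succ_le_succ h)]) K L
  rw [tabMeet, hK, hL, h]
  rfl

theorem tabJoin_eq_tabOf {n m : ℕ} {A B : List ℕ × List ℕ} {K L : Fin n → Fin (m + n)}
    (hK : xi n m A.1 A.2 = seqList K) (hL : xi n m B.1 B.2 = seqList L) :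
    tabJoin n m A B = tabOf n m (K ⊔ L) := by
  have h := zipWith_seqList max max (fun a b => by
    rcases le_total a b with h | h
    · rw [max_eq_right h, max_eq_right (Nat.succ_le_succ h)]
    · rw [max_eq_left h, max_eq_left (Nat.succ_le_succ h)]) K L
  rw [tabJoin, hK, hL, h]
  rfl

theorem succ_le_countP_le_iff {l : List ℕ} (hl : l.Pairwise (· < ·)) {r x : ℕ}
    (hr : r < l.length) : r + 1 ≤ l.countP (fun a => decide (a ≤ x)) ↔ l[r] ≤ x := by
  have hlt := List.pairwise_iff_getElem.1 hl
  constructor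
  · intro h
    by_contra! hx
    have hdrop : (l.drop r).countP (fun a => decide (a ≤ x)) = 0 := by
      rw [List.countP_eq_zero]
      intro a ha
      obtain ⟨i, hi, rfl⟩ := List.mem_iff_getElem.1 ha
      rw [List.getElem_drop, decide_eq_true_iff, not_le]
      rcases Nat.eq_zero_or_pos i with rfl | hi'
      · exact hx
      · rw [List.length_drop] at hi
        exact hx.trans (hlt r (r + i) hr (by omega) (by omega))
    have htake := List.countP_le_length (p := fun a => decide (a ≤ x)) (l := l.take r)
    rw [List.length_take] at htake
    have := List.countP_append (p := fun a => decide (a ≤ x)) (l₁ := l.take r) (l₂ := l.drop r)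
    rw [List.take_append_drop] at this
    omega
  · intro h
    have htake : (l.take (r + 1)).countP (fun a => decide (a ≤ x)) = r + 1 := by
      have hlen : (l.take (r + 1)).length = r + 1 := by
        rw [List.length_take]
        omega
      conv_rhs => rw [← hlen]
      rw [List.countP_eq_length]
      intro a ha
      obtain ⟨i, hi, rfl⟩ := List.mem_iff_getElem.1 ha
      rw [List.getElem_take, decide_eq_true_iff]
      rcases (show i ≤ r by omega).eq_or_lt with rfl | hi'
      · exact h
      · exact (hlt i r (by omega) hr hi').le.trans h
    rw [← htake]
    exact (List.take_sublist _ _).countP_le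

theorem countP_le_map_succ_range {n x : ℕ} (hx : x ≤ n) :
    ((List.range n).map (· + 1)).countP (fun a => decide (a ≤ x)) = x := by
  have h : ((List.range n).map (· + 1)).filter (fun a => decide (a ≤ x)) =
      (List.range x).map (· + 1) := by
    refine List.Pairwise.eq_of_mem_iff ((pairwise_lt_map_succ_range n).filter _)
      (pairwise_lt_map_succ_range x) fun a => ?_
    rw [List.mem_filter, mem_map_succ_range, mem_map_succ_range, decide_eq_true_iff]
    omega
  rw [List.countP_eq_length_filter, h, List.length_map, List.length_range]

theorem countP_le_complDesc {n m x : ℕ} {I J : List ℕ} (h : IsWeakTab n m I J) (hx : x ≤ n) :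
    (complDesc n I).countP (fun a => decide (a ≤ x)) =
      (xi n m I J).countP fun y => decide (m + (n + 1 - x) ≤ y) := by
  have hJ : J.countP (fun y => decide (m + (n + 1 - x) ≤ y)) = 0 := by
    rw [List.countP_eq_zero]
    intro y hy
    have := h.right_mem y hy
    rw [decide_eq_true_iff]
    omega
  rw [xi_eq_append, List.countP_append, hJ, zero_add, List.countP_map]
  refine List.countP_congr fun c hc => ?_
  have := (mem_complDesc.1 hc).1
  simp only [Function.comp_apply, decide_eq_true_iff]
  omega

theorem countP_seqList_mono {n N : ℕ} {K L : Fin n → Fin N} (hKL : K ≤ L) (y : ℕ) :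
    (seqList K).countP (fun a => decide (y ≤ a)) ≤ (seqList L).countP fun a => decide (y ≤ a) := by
  rw [seqList, seqList, List.ofFn_eq_map, List.ofFn_eq_map, List.countP_map, List.countP_map]
  refine List.countP_mono_left fun j _ => ?_
  simp only [Function.comp_apply, decide_eq_true_iff]
  have : (K j : ℕ) ≤ L j := hKL j
  omega

theorem tleq_of_le {n m : ℕ} {A B : List ℕ × List ℕ} {K L : Fin n → Fin (m + n)}
    (hA : IsWeakTab n m A.1 A.2) (hB : IsWeakTab n m B.1 B.2)
    (hK : xi n m A.1 A.2 = seqList K) (hL : xi n m B.1 B.2 = seqList L) (hKL : K ≤ L) :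
    tleq A B := by
  obtain ⟨I, J⟩ := A
  obtain ⟨I', J'⟩ := B
  dsimp only at hA hB hK hL
  have hlenI := hA.length_eq
  have hlenI' := hB.length_eq
  have hJn : J.length ≤ n := by
    have := length_complDesc_add hA.left_lt hA.left_mem
    omega
  have hJn' : J'.length ≤ n := by
    have := length_complDesc_add hB.left_lt hB.left_mem
    omega
  have hlenK : (xi n m I J).length = n := length_xi hA
  have hlenL : (xi n m I' J').length = n := length_xi hB
  have hget : ∀ r (hr : r < n), (xi n m I J)[r] ≤ (xi n m I' J')[r] := by
    intro r hr
    have : (K ⟨r, hr⟩ : ℕ) ≤ L ⟨r, hr⟩ := hKL ⟨r, hr⟩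
    simp only [hK, hL, getElem_seqList _ hr]
    omega
  have hright : ∀ r (hr : r < J'.length), (xi n m I' J')[r]'(by omega) = J'[r] :=
    fun r hr => List.getElem_append_left hr
  have hlen : J'.length ≤ J.length := by
    by_contra! hlt
    have h1 := hget J.length (by omega)
    rw [hright _ hlt] at h1
    have h2 := (hB.right_mem _ (List.getElem_mem hlt)).2
    have hc : 0 < (complDesc n I).length := by
      have := length_complDesc_add hA.left_lt hA.left_mem
      omega
    have h3 : (xi n m I J)[J.length]'(by omega) = m + (n + 1 - (complDesc n I)[0]) := by
      simp [xi_eq_append]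
    have h4 := (mem_complDesc.1 (List.getElem_mem hc)).1
    omega
  refine ⟨by dsimp only; omega, fun r hr => ?_⟩
  dsimp only at hr ⊢
  have hrI : r < I.length := by omega
  have hrJ : r < J.length := by omega
  have hrJ' : r < J'.length := by omega
  rw [List.getD_eq_getElem _ _ hrI, List.getD_eq_getElem _ _ hr, List.getD_eq_getElem _ _ hrJ,
    List.getD_eq_getElem _ _ hrJ']
  constructor
  · have hx := (hB.left_mem _ (List.getElem_mem hr)).2
    rw [← succ_le_countP_le_iff hA.left_lt hrI]
    have h1 := (succ_le_countP_le_iff hB.left_lt hr).2 (le_refl I'[r])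
    have h2 := countP_complDesc_add hA.left_lt hA.left_mem fun a => decide (a ≤ I'[r])
    have h3 := countP_complDesc_add hB.left_lt hB.left_mem fun a => decide (a ≤ I'[r])
    rw [countP_le_map_succ_range hx, countP_le_complDesc hA hx, hK] at h2
    rw [countP_le_map_succ_range hx, countP_le_complDesc hB hx, hL] at h3
    have h4 := countP_seqList_mono hKL (m + (n + 1 - I'[r]))
    omega
  · have h1 := hget r (by omega)
    rw [hright r hrJ'] at h1
    exact (List.getElem_append_left hrJ).symm.le.trans h1

/-- The specialization of the generic `n × (m + n)` matrix to the generic `n × m` matrix followed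
by a signed antidiagonal block, under which the maximal minors become all minors. -/
def minorSpec (n m : ℕ) (p : Fin n × Fin (m + n)) : MvPolynomial (Fin n × Fin m) ℂ :=
  if h : (p.2 : ℕ) < m then MvPolynomial.X (p.1, ⟨p.2, h⟩)
  else if (p.1 : ℕ) + (p.2 - m) + 1 = n then (-1) ^ ((p.1 : ℕ) + n + 1) else 0

theorem aeval_maxMinor_genericCol {n m : ℕ} {I J : List ℕ} {K : Fin n → Fin (m + n)}
    (h : IsWeakTab n m I J) (hK : xi n m I J = seqList K) :
    MvPolynomial.aeval (minorSpec n m) (maxMinor (genericCol n (m + n)) K) = dmin n m I J := by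
  have hlen := length_complDesc_add h.left_lt h.left_mem
  have hlenJ := h.length_eq
  obtain ⟨q, hq⟩ : ∃ q, q = (complDesc n I).length := ⟨_, rfl⟩
  obtain rfl : n = I.length + q := by omega
  have hIget : ∀ a : Fin I.length, 1 ≤ I[a] ∧ I[a] ≤ I.length + q :=
    fun a => h.left_mem _ (List.getElem_mem _)
  have hCget : ∀ b : Fin q, (1 ≤ (complDesc (I.length + q) I)[b] ∧
      (complDesc (I.length + q) I)[b] ≤ I.length + q) ∧ (complDesc (I.length + q) I)[b] ∉ I :=
    fun b => mem_complDesc.1 (List.getElem_mem _)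
  have hJget : ∀ a : Fin I.length, 1 ≤ J[a] ∧ J[a] ≤ m :=
    fun a => h.right_mem _ (List.getElem_mem _)
  let rowI : Fin I.length → Fin (I.length + q) := fun a => ⟨I[a] - 1, by have := hIget a; omega⟩
  let rowC : Fin q → Fin (I.length + q) :=
    fun b => ⟨(complDesc (I.length + q) I)[b] - 1, by have := (hCget b).1; omega⟩
  let colJ : Fin I.length → Fin m := fun a => ⟨J[a] - 1, by have := hJget a; omega⟩
  have hKJ : ∀ a : Fin I.length, (K (Fin.castAdd q a) : ℕ) = J[a] - 1 := by
    intro a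
    have h1 := getElem_seqList K (Fin.castAdd q a).isLt
    simp only [← hK, xi_eq_append] at h1
    rw [List.getElem_append_left (by simp; omega)] at h1
    have h2 : J[a] = (K (Fin.castAdd q a) : ℕ) + 1 := h1
    omega
  have hKC : ∀ b : Fin q, (K (Fin.natAdd I.length b) : ℕ) =
      m + (I.length + q - (complDesc (I.length + q) I)[b]) := by
    intro b
    have h1 := getElem_seqList K (Fin.natAdd I.length b).isLt
    simp only [← hK, xi_eq_append, Fin.val_natAdd] at h1
    rw [List.getElem_append_right (by omega), List.getElem_map] at h1
    have h2 : I.length + (b : ℕ) - J.length = b := by omega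
    simp only [h2] at h1
    have h3 : m + (I.length + q + 1 - (complDesc (I.length + q) I)[b]) =
      (K (Fin.natAdd I.length b) : ℕ) + 1 := h1
    have h4 := (hCget b).1
    omega
  have hmat : (Matrix.of fun j => genericCol (I.length + q) (m + (I.length + q)) (K j)).map
      (MvPolynomial.aeval (minorSpec (I.length + q) m)) = Matrix.of (Fin.append
        (fun a k => MvPolynomial.X (k, colJ a))
        (fun b => Pi.single (rowC b) ((-1) ^ ((rowC b : ℕ) + (I.length + q) + 1)))) := by
    refine Matrix.ext fun j k => ?_
    rw [Matrix.map_apply, Matrix.of_apply, Matrix.of_apply, genericCol, MvPolynomial.aeval_X]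
    refine Fin.addCases (fun a => ?_) (fun b => ?_) j
    · rw [Fin.append_left, minorSpec, dif_pos (by rw [hKJ]; have := hJget a; omega)]
      exact congrArg (fun c => MvPolynomial.X (k, c)) (Fin.ext (hKJ a))
    · have hb := (hCget b).1
      rw [Fin.append_right, minorSpec, dif_neg (by rw [hKC]; omega), Pi.single_apply]
      have hk := k.isLt
      have hiff : (k : ℕ) + ((K (Fin.natAdd I.length b) : ℕ) - m) + 1 = I.length + q ↔
          k = rowC b := by
        rw [hKC, Fin.ext_iff]
        dsimp only [rowC]
        omega
      refine (if_congr hiff rfl rfl).trans ?_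
      split_ifs with hkb
      · rw [hkb]
      · rfl
  have hI : StrictMono rowI := by
    intro a b hab
    have h1 := List.pairwise_iff_getElem.1 h.left_lt a b a.isLt b.isLt hab
    have h2 := hIget a
    rw [Fin.mk_lt_mk]
    simp only [Fin.getElem_fin] at h2 ⊢
    omega
  have hC : StrictAnti rowC := by
    intro a b hab
    have h1 := List.pairwise_iff_getElem.1 (pairwise_complDesc (I.length + q) I) a b
      (hq ▸ a.isLt) (hq ▸ b.isLt) hab
    have h2 := (hCget b).1
    rw [Fin.mk_lt_mk]
    simp only [Fin.getElem_fin] at h2 ⊢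
    omega
  have hIC : ∀ a b, rowI a ≠ rowC b := by
    intro a b hab
    have h1 := hIget a
    have h2 := hCget b
    have h3 : I[a] - 1 = (complDesc (I.length + q) I)[b] - 1 := congrArg Fin.val hab
    refine h2.2 ?_
    rw [show (complDesc (I.length + q) I)[b] = I[a] by omega]
    exact List.getElem_mem _
  rw [maxMinor, AlgHom.map_det, AlgHom.mapMatrix_apply, hmat,
    det_append_single q _ rowI rowC hI hC hIC, dmin, ← Matrix.det_transpose]
  congr 1
  refine Matrix.ext fun a b => ?_
  rw [Matrix.transpose_apply, Matrix.of_apply, Matrix.of_apply]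
  have h1 := hIget a
  have h2 := hJget b
  have e1 : I.getD a 0 = I[a] := List.getD_eq_getElem _ _ a.isLt
  have e2 : J.getD b 0 = J[b] := List.getD_eq_getElem _ _ (hlenJ ▸ b.isLt)
  simp only [e1, e2]
  rw [dif_pos ⟨by omega, by omega⟩]

theorem dmin_nil (n m : ℕ) : dmin n m [] [] = 1 :=
  Matrix.det_isEmpty (n := Fin 0)

theorem aeval_stdPair_prod {n m : ℕ} (s : StdPair n (m + n)) :
    MvPolynomial.aeval (minorSpec n m) s.prod =
      dmin n m (tabOf n m s.1.1).1 (tabOf n m s.1.1).2 *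
        dmin n m (tabOf n m s.1.2).1 (tabOf n m s.1.2).2 := by
  rw [StdPair.prod, map_mul,
    aeval_maxMinor_genericCol (isWeakTab_tabOf s.2.1) (xi_tabOf s.2.1),
    aeval_maxMinor_genericCol (isWeakTab_tabOf s.2.2.1) (xi_tabOf s.2.2.1)]

theorem lt_of_isTab {n m : ℕ} (hn : 0 < n) {I J : List ℕ} {K : Fin n → Fin (m + n)}
    (h : isTab n m I J) (hK : xi n m I J = seqList K) : (K ⟨0, hn⟩ : ℕ) < m := by
  obtain ⟨hw, hI⟩ := isTab_iff.1 h
  have hJ : 0 < J.length := hw.length_eq ▸ List.length_pos_of_ne_nil hI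
  have h1 := getElem_seqList K hn
  simp only [← hK, xi_eq_append] at h1
  rw [List.getElem_append_left hJ] at h1
  have := (hw.right_mem _ (List.getElem_mem hJ)).2
  omega

theorem straightening_in_CMnm (n m : ℕ) (hn : 0 < n) (hm : 0 < m) (A B : List ℕ × List ℕ)
    (hA : isTab n m A.1 A.2) (hB : isTab n m B.1 B.2) :
    ∃ (u : ℕ) (c : Fin u → ℂ) (X : Fin u → List ℕ × List ℕ)
      (Y : Fin u → Option (List ℕ × List ℕ)),
      (dmin n m A.1 A.2 * dmin n m B.1 B.2 =
        ∑ r, c r • (dmin n m (X r).1 (X r).2 *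
          (Y r).elim 1 (fun y => dmin n m y.1 y.2))) ∧
      (∀ r, isTab n m (X r).1 (X r).2 ∧
        (Y r).elim True (fun y => isTab n m y.1 y.2 ∧ tleq (X r) y)) ∧
      (∀ r, tleq (X r) (tabMeet n m A B) ∧
        (Y r).elim True (fun y => tleq (tabJoin n m A B) y)) ∧
      ∃ r0, c r0 = 1 ∧ X r0 = tabMeet n m A B ∧ Y r0 = some (tabJoin n m A B) ∧
        ∀ r, r ≠ r0 → ¬(X r = tabMeet n m A B ∧ Y r = some (tabJoin n m A B)) := by
  classical
  have hwA := (isTab_iff.1 hA).1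
  have hwB := (isTab_iff.1 hB).1
  obtain ⟨K, hK, hAK⟩ := exists_xi_eq_seqList hwA
  obtain ⟨L, hL, hBL⟩ := exists_xi_eq_seqList hwB
  have hK0 := lt_of_isTab hn hA hAK
  have hL0 := lt_of_isTab hn hB hBL
  have hinf : StrictMono (K ⊓ L) := fun i j hij =>
    lt_inf_iff.2 ⟨inf_le_left.trans_lt (hK hij), inf_le_right.trans_lt (hL hij)⟩
  have hsup : StrictMono (K ⊔ L) := fun i j hij =>
    sup_lt_iff.2 ⟨(hK hij).trans_le le_sup_left, (hL hij).trans_le le_sup_right⟩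
  have hsup0 : ((K ⊔ L) ⟨0, hn⟩ : ℕ) < m := by
    rcases le_total (K ⟨0, hn⟩) (L ⟨0, hn⟩) with h | h
    · rw [Pi.sup_apply, sup_eq_right.2 h]
      exact hL0
    · rw [Pi.sup_apply, sup_eq_left.2 h]
      exact hK0
  rw [tabMeet_eq_tabOf hAK hBL, tabJoin_eq_tabOf hAK hBL]
  obtain ⟨c, hc, hsum, hone⟩ := exists_straightening hK hL
  have hfst : ∀ s, c s ≠ 0 → (s.1.1 ⟨0, hn⟩ : ℕ) < m := fun s hs =>
    lt_of_le_of_lt (show (s.1.1 ⟨0, hn⟩ : ℕ) ≤ K ⟨0, hn⟩ from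
      ((hc s hs).1.trans inf_le_left) ⟨0, hn⟩) hK0
  let e := Fintype.equivFin {s : StdPair n (m + n) // c s ≠ 0}
  let Y : StdPair n (m + n) → Option (List ℕ × List ℕ) := fun s =>
    if (s.1.2 ⟨0, hn⟩ : ℕ) < m then some (tabOf n m s.1.2) else none
  have hY : ∀ s : StdPair n (m + n), (s.1.2 ⟨0, hn⟩ : ℕ) < m → Y s = some (tabOf n m s.1.2) :=
    fun s hs => if_pos hs
  have hY' : ∀ s : StdPair n (m + n), ¬ (s.1.2 ⟨0, hn⟩ : ℕ) < m → Y s = none :=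
    fun s hs => if_neg hs
  let s₀ : StdPair n (m + n) := ⟨(K ⊓ L, K ⊔ L), hinf, hsup, inf_le_sup⟩
  have hs₀ : c s₀ = 1 := hone s₀ rfl
  refine ⟨_, fun r => c (e.symm r).1, fun r => tabOf n m (e.symm r).1.1.1,
    fun r => Y (e.symm r).1, ?_, fun r => ?_, fun r => ?_, e ⟨s₀, hs₀ ▸ one_ne_zero⟩, ?_⟩
  · have h := congrArg (MvPolynomial.aeval (minorSpec n m)) hsum
    rw [map_mul, aeval_maxMinor_genericCol hwA hAK, aeval_maxMinor_genericCol hwB hBL,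
      map_sum] at h
    let f : StdPair n (m + n) → MvPolynomial (Fin n × Fin m) ℂ := fun s =>
      c s • (dmin n m (tabOf n m s.1.1).1 (tabOf n m s.1.1).2 *
        (Y s).elim 1 fun y => dmin n m y.1 y.2)
    have hf : ∀ s, MvPolynomial.aeval (minorSpec n m) (c s • s.prod) = f s := by
      intro s
      rw [map_smul, aeval_stdPair_prod]
      dsimp only [f]
      by_cases h0 : (s.1.2 ⟨0, hn⟩ : ℕ) < m
      · rw [hY s h0, Option.elim_some]
      · rw [hY' s h0, Option.elim_none, tabOf_eq_nil hn s.2.2.1 (not_lt.1 h0), dmin_nil]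
    rw [← h, Finset.sum_congr rfl fun s _ => hf s]
    refine Eq.trans ?_ (Equiv.sum_comp e.symm fun t => f t.1).symm
    rw [← Finset.sum_subtype (Finset.univ.filter fun s => c s ≠ 0) (by simp) f,
      Finset.sum_filter_of_ne]
    intro s _ hs h0
    exact hs (by rw [show f s = c s • _ from rfl, h0, zero_smul])
  · dsimp only
    generalize e.symm r = t
    obtain ⟨s, hs⟩ := t
    refine ⟨isTab_tabOf hn s.2.1 (hfst s hs), ?_⟩
    by_cases h : (s.1.2 ⟨0, hn⟩ : ℕ) < m
    · rw [hY s h]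
      exact ⟨isTab_tabOf hn s.2.2.1 h, tleq_of_le (isWeakTab_tabOf s.2.1)
        (isWeakTab_tabOf s.2.2.1) (xi_tabOf s.2.1) (xi_tabOf s.2.2.1) s.2.2.2⟩
    · rw [hY' s h]
      trivial
  · dsimp only
    generalize e.symm r = t
    obtain ⟨s, hs⟩ := t
    refine ⟨tleq_of_le (isWeakTab_tabOf s.2.1) (isWeakTab_tabOf hinf) (xi_tabOf s.2.1)
      (xi_tabOf hinf) (hc s hs).1, ?_⟩
    by_cases h : (s.1.2 ⟨0, hn⟩ : ℕ) < m
    · rw [hY s h]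
      exact tleq_of_le (isWeakTab_tabOf hsup) (isWeakTab_tabOf s.2.2.1) (xi_tabOf hsup)
        (xi_tabOf s.2.2.1) (hc s hs).2
    · rw [hY' s h]
      trivial
  · simp only [Equiv.symm_apply_apply]
    refine ⟨hs₀, rfl, hY s₀ hsup0, fun r hr ⟨h1, h2⟩ => hr ?_⟩
    rw [← Equiv.symm_apply_eq]
    generalize e.symm r = t at h1 h2 ⊢
    obtain ⟨s, hs⟩ := t
    by_cases h : (s.1.2 ⟨0, hn⟩ : ℕ) < m
    · rw [hY s h] at h2
      have e1 := tabOf_injective s.2.1 hinf h1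
      have e2 := tabOf_injective s.2.2.1 hsup (Option.some.inj h2)
      exact Subtype.ext (Subtype.ext (Prod.ext e1 e2))
    · rw [hY' s h] at h2
      cases h2

end
end
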